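/- arXiv:2012.14875 — 9 statements merged into one kernel-verified Lean document; each statement's English description precedes it below -/
import Mathlib

section
/- Let σ : ℕ → ℝ be a nonincreasing sequence with 0 < σ_k ≤ 1 for all k and σ_k → 0, let a : ℕ → ℝ be a nonnegative summable sequence, and let p, q, μ be real numbers with p > 0, q ≥ 0, μ > 0 and 0 < q + 4μ < 2p. Then there exist constants C > 0 and λ₀ > 0 such that Σ_{i=1}^∞ (σ_i^q · λ² / (σ_i^p + λ)²) · a_i ≤ C · λ^{(q+4μ)/p} for all 0 < λ ≤ λ₀, if and only if there exist constants C' > 0 and k₀ such that Σ_{n=k}^∞ a_n ≤ C' · σ_k^{4μ} for all k ≥ k₀. -/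
/-- A sequence that vanishes eventually and whose decrements are dominated by a geometric
sequence is bounded by the sum of the geometric series. -/
theorem le_div_one_sub_of_le_geometric_add {u : ℕ → ℝ} {K x : ℝ} (hK : 0 ≤ K) (hx0 : 0 ≤ x)
    (hx1 : x < 1) (hstep : ∀ n, u n ≤ K * x ^ n + u (n + 1)) (hend : ∃ n, u n ≤ 0) :
    u 0 ≤ K / (1 - x) := by
  have key : ∀ n, u 0 ≤ K * ∑ j ∈ Finset.range n, x ^ j + u n := by
    intro n
    induction n with
    | zero => simp
    | succ n ih =>
      rw [Finset.sum_range_succ]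
      linarith [hstep n]
  obtain ⟨n, hn⟩ := hend
  have hgeom : ∑ j ∈ Finset.range n, x ^ j ≤ (1 - x)⁻¹ := by
    rw [← tsum_geometric_of_lt_one hx0 hx1]
    exact (summable_geometric_of_lt_one hx0 hx1).sum_le_tsum _ fun j _ => pow_nonneg hx0 j
  rw [div_eq_mul_inv]
  linarith [key n, mul_le_mul_of_nonneg_left hgeom hK]

theorem sum_ite_le_le_tsum_nat_add {a : ℕ → ℝ} (ha : ∀ i, 0 ≤ a i) (hsum : Summable a)
    (F : Finset ℕ) (k : ℕ) :
    ∑ i ∈ F, (if k ≤ i then a i else 0) ≤ ∑' n, a (k + n) := by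
  have hnonneg : ∀ i, 0 ≤ (if k ≤ i then a i else 0) := fun i => by
    split_ifs
    exacts [ha i, le_rfl]
  have hs : Summable fun i => if k ≤ i then a i else 0 :=
    hsum.of_nonneg_of_le hnonneg fun i => by
      split_ifs
      exacts [le_rfl, ha i]
  refine (hs.sum_le_tsum F fun i _ => hnonneg i).trans_eq ?_
  rw [← hs.sum_add_tsum_nat_add k, Finset.sum_eq_zero fun i hi => ?_, zero_add]
  · simp [add_comm k]
  · simp [Finset.mem_range.1 hi]

/-- A tail bound along the sequence `σ` gives a bound on the mass of every sublevel set of `σ`. -/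
theorem exists_sum_sublevel_le_rpow {σ a : ℕ → ℝ} (hσ_anti : Antitone σ) (hσ_pos : ∀ k, 0 < σ k)
    (hσ_lim : Filter.Tendsto σ Filter.atTop (nhds 0)) (ha : ∀ i, 0 ≤ a i) (hsum : Summable a)
    {r C : ℝ} (hr : 0 ≤ r) {k₀ : ℕ}
    (htail : ∀ k, k₀ ≤ k → ∑' n, a (k + n) ≤ C * σ k ^ r) :
    ∃ D > 0, ∀ s > 0, ∀ F : Finset ℕ,
      ∑ i ∈ F, (if σ i ≤ s then a i else 0) ≤ D * s ^ r := by
  have hA : 0 ≤ ∑' i, a i := tsum_nonneg ha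
  have hσr : 0 < σ k₀ ^ r := Real.rpow_pos_of_pos (hσ_pos k₀) r
  set D := max C ((∑' i, a i) / σ k₀ ^ r) + 1
  have hD : 0 < D := by
    have : 0 ≤ (∑' i, a i) / σ k₀ ^ r := div_nonneg hA hσr.le
    linarith [le_max_right C ((∑' i, a i) / σ k₀ ^ r)]
  refine ⟨D, hD, fun s hs F => ?_⟩
  have hex : ∃ k, σ k ≤ s := ((hσ_lim.eventually (gt_mem_nhds hs)).exists).imp fun _ h => h.le
  classical
  set k := Nat.find hex
  have hk : σ k ≤ s := Nat.find_spec hex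
  have htail' : ∑' n, a (k + n) ≤ D * σ k ^ r := by
    rcases le_total k₀ k with h | h
    · refine (htail k h).trans (mul_le_mul_of_nonneg_right ?_ (Real.rpow_nonneg (hσ_pos k).le r))
      linarith [le_max_left C ((∑' i, a i) / σ k₀ ^ r)]
    · have hle : ∑' n, a (k + n) ≤ ∑' i, a i := by
        have := hsum.sum_add_tsum_nat_add k
        have hpos := Finset.sum_nonneg fun i (_ : i ∈ Finset.range k) => ha i
        simp only [add_comm k]
        linarith
      calc ∑' n, a (k + n) ≤ (∑' i, a i) / σ k₀ ^ r * σ k₀ ^ r := by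
            rwa [div_mul_cancel₀ _ hσr.ne']
        _ ≤ D * σ k ^ r := by
            gcongr
            · linarith [le_max_right C ((∑' i, a i) / σ k₀ ^ r)]
            · exact (hσ_pos k₀).le
            · exact hσ_anti h
  calc ∑ i ∈ F, (if σ i ≤ s then a i else 0)
      ≤ ∑ i ∈ F, (if k ≤ i then a i else 0) := by
        refine Finset.sum_le_sum fun i _ => ?_
        by_cases h : σ i ≤ s
        · rw [if_pos h, if_pos (Nat.find_min' hex h)]
        · rw [if_neg h]
          split_ifs
          exacts [ha i, le_rfl]
    _ ≤ ∑' n, a (k + n) := sum_ite_le_le_tsum_nat_add ha hsum F k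
    _ ≤ D * σ k ^ r := htail'
    _ ≤ D * s ^ r := by
        gcongr
        exact (hσ_pos k).le

theorem rpow_mul_pow_rpow {s c : ℝ} (hs : 0 < s) (hc : 0 < c) (r : ℝ) (n : ℕ) :
    (s * c ^ n) ^ r = s ^ r * (c ^ r) ^ n := by
  rw [Real.mul_rpow hs.le (by positivity), ← Real.rpow_natCast c, ← Real.rpow_natCast (c ^ r),
    ← Real.rpow_mul hc.le, ← Real.rpow_mul hc.le, mul_comm r]

/-- If the mass of `σ` in each dyadic shell is controlled by the filtered sums, then the mass of
small sublevel sets of `σ` obeys a power law. -/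
theorem sum_sublevel_le_of_filtered_sum_le {σ a : ℕ → ℝ} (hσ_pos : ∀ k, 0 < σ k)
    (ha : ∀ i, 0 ≤ a i) {p q r C lam₀ : ℝ} (hp : 0 < p) (hq : 0 ≤ q) (hr : 0 < r) (hC : 0 ≤ C)
    (F : Finset ℕ)
    (hrate : ∀ lam : ℝ, 0 < lam → lam ≤ lam₀ →
      ∑ i ∈ F, σ i ^ q * lam ^ 2 / (σ i ^ p + lam) ^ 2 * a i ≤ C * lam ^ ((q + r) / p))
    {s : ℝ} (hs : 0 < s) (hs₀ : s ^ p ≤ lam₀) :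
    ∑ i ∈ F, (if σ i ≤ s then a i else 0) ≤
      4 * 2 ^ q * C / (1 - (1 / 2 : ℝ) ^ r) * s ^ r := by
  have step : ∀ t > 0, t ≤ s → ∑ i ∈ F, (if σ i ≤ t then a i else 0) ≤
      4 * 2 ^ q * C * t ^ r + ∑ i ∈ F, (if σ i ≤ t * (1 / 2) then a i else 0) := by
    intro t ht hts
    have htp : 0 < t ^ p := Real.rpow_pos_of_pos ht p
    have htq : 0 < t ^ q := Real.rpow_pos_of_pos ht q
    have h2q : (0 : ℝ) < 2 ^ q := by positivity
    have hpt : ∀ i ∈ F, (if σ i ≤ t then a i else 0) ≤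
        4 * 2 ^ q / t ^ q * (σ i ^ q * (t ^ p) ^ 2 / (σ i ^ p + t ^ p) ^ 2 * a i) +
          (if σ i ≤ t * (1 / 2) then a i else 0) := by
      intro i _
      have hip : 0 < σ i ^ p := Real.rpow_pos_of_pos (hσ_pos i) p
      have hiq : 0 < σ i ^ q := Real.rpow_pos_of_pos (hσ_pos i) q
      have hai := ha i
      have hterm : 0 ≤
          4 * 2 ^ q / t ^ q * (σ i ^ q * (t ^ p) ^ 2 / (σ i ^ p + t ^ p) ^ 2 * a i) := by
        positivity
      by_cases h1 : σ i ≤ t * (1 / 2)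
      · rw [if_pos h1, if_pos (by linarith)]
        linarith
      by_cases h2 : σ i ≤ t
      · rw [if_pos h2, if_neg h1, add_zero]
        have hA : σ i ^ p ≤ t ^ p := Real.rpow_le_rpow (hσ_pos i).le h2 hp.le
        have hB : t ^ q ≤ 2 ^ q * σ i ^ q := by
          rw [← Real.mul_rpow (by norm_num) (hσ_pos i).le]
          exact Real.rpow_le_rpow ht.le (by linarith) hq
        have hfrac : 1 / 4 ≤ (t ^ p) ^ 2 / (σ i ^ p + t ^ p) ^ 2 := by
          rw [div_le_div_iff₀ (by norm_num) (by positivity)]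
          nlinarith
        have hone : 1 ≤ 2 ^ q * σ i ^ q / t ^ q := (one_le_div htq).2 hB
        calc a i = 1 * (4 * (1 / 4)) * a i := by ring
          _ ≤ (2 ^ q * σ i ^ q / t ^ q) * (4 * ((t ^ p) ^ 2 / (σ i ^ p + t ^ p) ^ 2)) * a i := by
              gcongr
          _ = _ := by ring
      · rw [if_neg h2, if_neg h1]
        linarith
    have hsummed := Finset.sum_le_sum hpt
    rw [Finset.sum_add_distrib, ← Finset.mul_sum] at hsummed
    have hb := hrate (t ^ p) htp ((Real.rpow_le_rpow ht.le hts hp.le).trans hs₀)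
    rw [← Real.rpow_mul ht.le, mul_div_cancel₀ _ hp.ne', Real.rpow_add ht] at hb
    have hb' := mul_le_mul_of_nonneg_left hb (by positivity : 0 ≤ 4 * 2 ^ q / t ^ q)
    have heq : 4 * 2 ^ q / t ^ q * (C * (t ^ q * t ^ r)) = 4 * 2 ^ q * C * t ^ r := by
      field_simp
    linarith
  have hhalf : (1 / 2 : ℝ) ^ r < 1 := Real.rpow_lt_one (by norm_num) (by norm_num) hr
  have hsr : 0 < s ^ r := Real.rpow_pos_of_pos hs r
  have hmain := le_div_one_sub_of_le_geometric_add
    (u := fun n => ∑ i ∈ F, (if σ i ≤ s * (1 / 2) ^ n then a i else 0))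
    (K := 4 * 2 ^ q * C * s ^ r) (x := (1 / 2 : ℝ) ^ r) (by positivity) (by positivity) hhalf
    (fun n => by
      have h := step (s * (1 / 2) ^ n) (by positivity)
        (mul_le_of_le_one_right hs.le (pow_le_one₀ (by norm_num) (by norm_num)))
      rw [rpow_mul_pow_rpow hs (by norm_num)] at h
      simp only [pow_succ, ← mul_assoc] at h ⊢
      exact h)
    (by
      have hlim : Filter.Tendsto (fun n : ℕ => s * (1 / 2 : ℝ) ^ n) Filter.atTop (nhds 0) := by
        simpa using (tendsto_pow_atTop_nhds_zero_of_lt_one (by norm_num : (0 : ℝ) ≤ 1 / 2)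
          (by norm_num)).const_mul s
      have hev : ∀ᶠ n : ℕ in Filter.atTop, ∀ i ∈ F, s * (1 / 2 : ℝ) ^ n < σ i :=
        (Filter.eventually_all_finset F).2 fun i _ => hlim.eventually (gt_mem_nhds (hσ_pos i))
      obtain ⟨n, hn⟩ := hev.exists
      exact ⟨n, (Finset.sum_eq_zero fun i hi => if_neg (hn i hi).not_ge).le⟩)
  simp only [pow_zero, mul_one] at hmain
  refine hmain.trans_eq ?_
  ring

/-- A power law for the mass of sublevel sets of `σ` controls negative moments of `σ` over
superlevel sets. -/
theorem sum_superlevel_rpow_le {σ a : ℕ → ℝ} (ha : ∀ i, 0 ≤ a i) {r e D : ℝ}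
    (he : e ≤ 0) (her : e + r < 0) (hD : 0 ≤ D)
    (F : Finset ℕ)
    (hmass : ∀ s > 0, ∑ i ∈ F, (if σ i ≤ s then a i else 0) ≤ D * s ^ r) {s : ℝ} (hs : 0 < s) :
    ∑ i ∈ F, (if s < σ i then σ i ^ e * a i else 0) ≤
      D * 2 ^ r / (1 - (2 : ℝ) ^ (e + r)) * s ^ (e + r) := by
  have step : ∀ t > 0, ∑ i ∈ F, (if t < σ i then σ i ^ e * a i else 0) ≤
      D * 2 ^ r * t ^ (e + r) + ∑ i ∈ F, (if t * 2 < σ i then σ i ^ e * a i else 0) := by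
    intro t ht
    have hte : 0 < t ^ e := Real.rpow_pos_of_pos ht e
    have hpt : ∀ i ∈ F, (if t < σ i then σ i ^ e * a i else 0) ≤
        t ^ e * (if σ i ≤ t * 2 then a i else 0) +
          (if t * 2 < σ i then σ i ^ e * a i else 0) := by
      intro i _
      have hai := ha i
      by_cases h1 : t * 2 < σ i
      · rw [if_pos h1, if_pos (by linarith), if_neg h1.not_ge]
        simp
      · rw [if_neg h1, if_pos (not_lt.1 h1), add_zero]
        split_ifs with h2
        · exact mul_le_mul_of_nonneg_right (Real.rpow_le_rpow_of_nonpos ht h2.le he) hai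
        · positivity
    have hsummed := Finset.sum_le_sum hpt
    rw [Finset.sum_add_distrib, ← Finset.mul_sum] at hsummed
    have hb := mul_le_mul_of_nonneg_left (hmass (t * 2) (by positivity)) hte.le
    rw [Real.mul_rpow ht.le (by norm_num)] at hb
    rw [Real.rpow_add ht]
    linarith
  have htwo : (2 : ℝ) ^ (e + r) < 1 := Real.rpow_lt_one_of_one_lt_of_neg (by norm_num) her
  have hmain := le_div_one_sub_of_le_geometric_add
    (u := fun n => ∑ i ∈ F, (if s * 2 ^ n < σ i then σ i ^ e * a i else 0))
    (K := D * 2 ^ r * s ^ (e + r)) (x := (2 : ℝ) ^ (e + r)) (by positivity) (by positivity) htwo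
    (fun n => by
      have h := step (s * 2 ^ n) (by positivity)
      rw [rpow_mul_pow_rpow hs (by norm_num)] at h
      simp only [pow_succ, ← mul_assoc] at h ⊢
      exact h)
    (by
      have hlim : Filter.Tendsto (fun n : ℕ => s * (2 : ℝ) ^ n) Filter.atTop Filter.atTop :=
        (tendsto_pow_atTop_atTop_of_one_lt (by norm_num)).const_mul_atTop hs
      have hev : ∀ᶠ n : ℕ in Filter.atTop, ∀ i ∈ F, σ i ≤ s * (2 : ℝ) ^ n :=
        (Filter.eventually_all_finset F).2 fun i _ => hlim.eventually_ge_atTop (σ i)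
      obtain ⟨n, hn⟩ := hev.exists
      exact ⟨n, (Finset.sum_eq_zero fun i hi => if_neg (hn i hi).not_gt).le⟩)
  simp only [pow_zero, mul_one] at hmain
  refine hmain.trans_eq ?_
  ring

theorem filtered_term_le {x p q s y : ℝ} (hx : 0 < x) (hq : 0 ≤ q) (hs : 0 < s) (hy : 0 ≤ y) :
    x ^ q * (s ^ p) ^ 2 / (x ^ p + s ^ p) ^ 2 * y ≤
      s ^ q * (if x ≤ s then y else 0) +
        s ^ (2 * p) * (if s < x then x ^ (q - 2 * p) * y else 0) := by
  have hxp : 0 < x ^ p := Real.rpow_pos_of_pos hx p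
  have hxq : 0 < x ^ q := Real.rpow_pos_of_pos hx q
  have hsp : 0 < s ^ p := Real.rpow_pos_of_pos hs p
  have hsq : ∀ z : ℝ, 0 < z → z ^ (2 * p) = (z ^ p) ^ 2 := fun z hz => by
    rw [mul_comm, Real.rpow_mul hz.le, Real.rpow_two]
  rcases le_or_gt x s with h | h
  · rw [if_pos h, if_neg h.not_gt, mul_zero, add_zero]
    gcongr
    rw [div_le_iff₀ (by positivity)]
    have : x ^ q ≤ s ^ q := Real.rpow_le_rpow hx.le h hq
    gcongr
    linarith
  · rw [if_neg h.not_ge, if_pos h, mul_zero, zero_add, Real.rpow_sub hx, hsq s hs, hsq x hx]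
    calc x ^ q * (s ^ p) ^ 2 / (x ^ p + s ^ p) ^ 2 * y
        ≤ x ^ q * (s ^ p) ^ 2 / (x ^ p) ^ 2 * y := by
          gcongr
          linarith
      _ = _ := by ring

/-- Lemma 1 (Lemma `lem:sumeval`): equivalence between the filtered-sum decay rate and the
tail form of the Hölder source condition. -/
theorem residual_sum_rate_iff_tail_source_condition
    (σ : ℕ → ℝ) (hσ_anti : Antitone σ) (hσ_pos : ∀ k, 0 < σ k) (hσ_le : ∀ k, σ k ≤ 1)
    (hσ_lim : Filter.Tendsto σ Filter.atTop (nhds 0))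
    (a : ℕ → ℝ) (ha : ∀ i, 0 ≤ a i) (hsum : Summable a)
    (p q μ : ℝ) (hp : 0 < p) (hq : 0 ≤ q) (hμ : 0 < μ)
    (h1 : 0 < q + 4 * μ) (h2 : q + 4 * μ < 2 * p) :
    (∃ C > (0 : ℝ), ∃ lam₀ > (0 : ℝ), ∀ lam : ℝ, 0 < lam → lam ≤ lam₀ →
        ∑' i : ℕ, σ i ^ q * lam ^ 2 / (σ i ^ p + lam) ^ 2 * a i
          ≤ C * lam ^ ((q + 4 * μ) / p))
      ↔ (∃ C' > (0 : ℝ), ∃ k₀ : ℕ, ∀ k : ℕ, k₀ ≤ k →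
          ∑' n : ℕ, a (k + n) ≤ C' * σ k ^ (4 * μ)) := by
  have hterm : ∀ lam : ℝ, 0 < lam → ∀ i,
      0 ≤ σ i ^ q * lam ^ 2 / (σ i ^ p + lam) ^ 2 * a i := fun lam hlam i => by
    have := Real.rpow_nonneg (hσ_pos i).le q
    have := ha i
    positivity
  constructor
  · rintro ⟨C, hC, lam₀, hlam₀, hrate⟩
    have hsummable : ∀ lam : ℝ, 0 < lam →
        Summable fun i => σ i ^ q * lam ^ 2 / (σ i ^ p + lam) ^ 2 * a i := fun lam hlam =>
      hsum.of_nonneg_of_le (hterm lam hlam) fun i => by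
        have hip : 0 < σ i ^ p := Real.rpow_pos_of_pos (hσ_pos i) p
        have hiq : σ i ^ q ≤ 1 := Real.rpow_le_one (hσ_pos i).le (hσ_le i) hq
        refine mul_le_of_le_one_left (ha i) ?_
        rw [div_le_one (by positivity)]
        calc σ i ^ q * lam ^ 2 ≤ 1 * lam ^ 2 := by gcongr
          _ ≤ (σ i ^ p + lam) ^ 2 := by
            rw [one_mul]
            gcongr
            linarith
    have hhalf : (1 / 2 : ℝ) ^ (4 * μ) < 1 :=
      Real.rpow_lt_one (by norm_num) (by norm_num) (by positivity)
    have hden : 0 < 1 - (1 / 2 : ℝ) ^ (4 * μ) := sub_pos.2 hhalf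
    have hlim : Filter.Tendsto (fun k => σ k ^ p) Filter.atTop (nhds 0) := by
      simpa [Real.zero_rpow hp.ne'] using hσ_lim.rpow_const (Or.inr hp.le)
    obtain ⟨k₀, hk₀⟩ := Filter.eventually_atTop.1 (hlim.eventually (gt_mem_nhds hlam₀))
    refine ⟨4 * 2 ^ q * C / (1 - (1 / 2 : ℝ) ^ (4 * μ)), by positivity, k₀, fun k hk => ?_⟩
    refine Real.tsum_le_of_sum_range_le (fun n => ha _) fun N => ?_
    refine le_trans (le_of_eq ?_) (sum_sublevel_le_of_filtered_sum_le hσ_pos ha hp hq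
      (by positivity) hC.le (Finset.Ico k (k + N))
      (fun lam hlam hle => ((hsummable lam hlam).sum_le_tsum _ fun i _ => hterm lam hlam i).trans
        (hrate lam hlam hle)) (hσ_pos k) (hk₀ k hk).le)
    rw [Finset.sum_Ico_eq_sum_range, Nat.add_sub_cancel_left]
    exact Finset.sum_congr rfl fun n _ => (if_pos (hσ_anti (Nat.le_add_right k n))).symm
  · rintro ⟨C, -, k₀, htail⟩
    obtain ⟨D, hD, hmass⟩ := exists_sum_sublevel_le_rpow hσ_anti hσ_pos hσ_lim ha hsum
      (by positivity : 0 ≤ 4 * μ) htail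
    have he : q - 2 * p + 4 * μ < 0 := by linarith
    have hden : 0 < 1 - (2 : ℝ) ^ (q - 2 * p + 4 * μ) :=
      sub_pos.2 (Real.rpow_lt_one_of_one_lt_of_neg (by norm_num) he)
    set E := D * 2 ^ (4 * μ) / (1 - (2 : ℝ) ^ (q - 2 * p + 4 * μ))
    have hE : 0 < E := by positivity
    refine ⟨D + E, by positivity, 1, one_pos, fun lam hlam _ => ?_⟩
    obtain ⟨s, hs, rfl⟩ : ∃ s : ℝ, 0 < s ∧ s ^ p = lam :=
      ⟨lam ^ p⁻¹, Real.rpow_pos_of_pos hlam _, Real.rpow_inv_rpow hlam.le hp.ne'⟩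
    refine Real.tsum_le_of_sum_range_le (hterm _ hlam) fun N => ?_
    have hsummed := Finset.sum_le_sum fun i (_ : i ∈ Finset.range N) =>
      filtered_term_le (p := p) (hσ_pos i) hq hs (ha i)
    rw [Finset.sum_add_distrib, ← Finset.mul_sum, ← Finset.mul_sum] at hsummed
    have hlow := mul_le_mul_of_nonneg_left (hmass s hs (Finset.range N))
      (Real.rpow_nonneg hs.le q)
    have hhigh := mul_le_mul_of_nonneg_left (sum_superlevel_rpow_le ha (by linarith) he
      hD.le (Finset.range N) (fun t ht => hmass t ht _) hs) (Real.rpow_nonneg hs.le (2 * p))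
    have hexp_low : s ^ q * (D * s ^ (4 * μ)) = D * s ^ (q + 4 * μ) := by
      rw [Real.rpow_add hs]
      ring
    have hexp_high : s ^ (2 * p) * (E * s ^ (q - 2 * p + 4 * μ)) = E * s ^ (q + 4 * μ) := by
      rw [mul_left_comm, ← Real.rpow_add hs]
      ring_nf
    rw [← Real.rpow_mul hs.le, mul_div_cancel₀ _ hp.ne']
    linarith
end

section
/- Let σ : ℕ → ℝ be a nonincreasing sequence with 0 < σ_k ≤ 1 for all k and σ_k → 0, let a : ℕ → ℝ be nonnegative and summable, and let p, q, μ be real numbers with p > 0, q ≥ 0, μ > 0. Assume the tail condition: there exist C' > 0 and k₀ with Σ_{n=k}^∞ a_n ≤ C' · σ_k^{4μ} for all k ≥ k₀. Then there exist C > 0 and λ₀ > 0 such that for all 0 < λ ≤ λ₀, the sum over the small singular values satisfies Σ_{i : σ_i^p ≤ λ} (σ_i^q · λ² / (σ_i^p + λ)²) · a_i ≤ C · λ^{(q+4μ)/p}. -/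
/-- If `x ^ p ≤ y` then `x ^ r ≤ y ^ (r / p)`. -/
theorem rpow_le_rpow_div_of_rpow_le {x y p r : ℝ} (hx : 0 ≤ x) (hp : 0 < p) (hr : 0 ≤ r)
    (h : x ^ p ≤ y) : x ^ r ≤ y ^ (r / p) := by
  calc x ^ r = (x ^ p) ^ (r / p) := by
        rw [← Real.rpow_mul hx, mul_div_cancel₀ r hp.ne']
    _ ≤ y ^ (r / p) := Real.rpow_le_rpow (Real.rpow_nonneg hx p) h (div_nonneg hr hp.le)

/-- Small-singular-value part of Lemma `lem:sumeval`: under the tail source condition, the sum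
over indices with `σ i ^ p ≤ λ` is `O(λ^((q+4μ)/p))` as `λ → 0⁺`. -/
theorem small_singular_values_sum_bound
    (σ : ℕ → ℝ) (hσ_anti : Antitone σ) (hσ_pos : ∀ k, 0 < σ k) (hσ_le : ∀ k, σ k ≤ 1)
    (hσ_lim : Filter.Tendsto σ Filter.atTop (nhds 0))
    (a : ℕ → ℝ) (ha : ∀ i, 0 ≤ a i) (hsum : Summable a)
    (p q μ : ℝ) (hp : 0 < p) (hq : 0 ≤ q) (hμ : 0 < μ)
    (htail : ∃ C' > (0 : ℝ), ∃ k₀ : ℕ, ∀ k : ℕ, k₀ ≤ k →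
      ∑' n : ℕ, a (k + n) ≤ C' * σ k ^ (4 * μ)) :
    ∃ C > (0 : ℝ), ∃ lam₀ > (0 : ℝ), ∀ lam : ℝ, 0 < lam → lam ≤ lam₀ →
      ∑' i : ℕ, (if σ i ^ p ≤ lam then σ i ^ q * lam ^ 2 / (σ i ^ p + lam) ^ 2 * a i else 0)
        ≤ C * lam ^ ((q + 4 * μ) / p) := by
  obtain ⟨C', hC', k₀, htail⟩ := htail
  refine ⟨C', hC', σ k₀ ^ p / 2, half_pos (Real.rpow_pos_of_pos (hσ_pos k₀) p), ?_⟩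
  intro lam hlam hlam_le
  have hlt : lam < σ k₀ ^ p := hlam_le.trans_lt (half_lt_self (Real.rpow_pos_of_pos (hσ_pos k₀) p))
  have hex : ∃ k, σ k ^ p ≤ lam := by
    have hlim : Filter.Tendsto (fun k => σ k ^ p) Filter.atTop (nhds 0) := by
      simpa [Real.zero_rpow hp.ne'] using hσ_lim.rpow_const (Or.inr hp.le)
    exact (hlim.eventually_le_const hlam).exists
  classical
  obtain ⟨k, hk, hmin⟩ : ∃ k, σ k ^ p ≤ lam ∧ ∀ i < k, ¬ σ i ^ p ≤ lam :=
    ⟨Nat.find hex, Nat.find_spec hex, fun _ => Nat.find_min hex⟩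
  have hk₀ : k₀ ≤ k := by
    by_contra! h
    exact (hlt.trans_le (Real.rpow_le_rpow (hσ_pos k₀).le (hσ_anti h.le) hp.le)).not_ge hk
  set f : ℕ → ℝ := fun i =>
    if σ i ^ p ≤ lam then σ i ^ q * lam ^ 2 / (σ i ^ p + lam) ^ 2 * a i else 0 with hf
  have hf_nonneg : ∀ i, 0 ≤ f i := by
    intro i
    have := hσ_pos i
    have := ha i
    simp only [hf]
    split_ifs <;> positivity
  have hf_le : ∀ i, f i ≤ lam ^ (q / p) * a i := by
    intro i
    have hσi := Real.rpow_pos_of_pos (hσ_pos i) p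
    simp only [hf]
    split_ifs with h
    · refine mul_le_mul_of_nonneg_right ?_ (ha i)
      calc σ i ^ q * lam ^ 2 / (σ i ^ p + lam) ^ 2 ≤ σ i ^ q := by
            rw [div_le_iff₀ (by positivity)]
            exact mul_le_mul_of_nonneg_left (pow_le_pow_left₀ hlam.le (by linarith) 2)
              (Real.rpow_nonneg (hσ_pos i).le q)
        _ ≤ lam ^ (q / p) := rpow_le_rpow_div_of_rpow_le (hσ_pos i).le hp hq h
    · exact mul_nonneg (Real.rpow_nonneg hlam.le _) (ha i)
  have hf_sum : Summable f := Summable.of_nonneg_of_le hf_nonneg hf_le (hsum.mul_left _)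
  have hhead : ∑ i ∈ Finset.range k, f i = 0 :=
    Finset.sum_eq_zero fun i hi => if_neg (hmin i (Finset.mem_range.mp hi))
  have hshift : Summable fun n => a (k + n) := by
    simpa only [add_comm k] using (summable_nat_add_iff k).mpr hsum
  calc ∑' i, f i = ∑' n, f (k + n) := by
        rw [← hf_sum.sum_add_tsum_nat_add k, hhead, zero_add]
        simp only [add_comm k]
    _ ≤ ∑' n, lam ^ (q / p) * a (k + n) :=
        Summable.tsum_le_tsum (fun n => hf_le (k + n))
          (by simpa only [add_comm k] using (summable_nat_add_iff k).mpr hf_sum)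
          (hshift.mul_left _)
    _ = lam ^ (q / p) * ∑' n, a (k + n) := tsum_mul_left
    _ ≤ lam ^ (q / p) * (C' * lam ^ (4 * μ / p)) := by
        refine mul_le_mul_of_nonneg_left ((htail k hk₀).trans ?_) (Real.rpow_nonneg hlam.le _)
        exact mul_le_mul_of_nonneg_left
          (rpow_le_rpow_div_of_rpow_le (hσ_pos k).le hp (by positivity) hk) hC'.le
    _ = C' * lam ^ ((q + 4 * μ) / p) := by
        rw [add_div, Real.rpow_add hlam]
        ring
end

section
/- Let σ : ℕ → ℝ be a nonincreasing sequence with 0 < σ_k ≤ 1 for all k and σ_k → 0, let a : ℕ → ℝ be nonnegative and summable, and let p, q, μ be real numbers with p > 0, q ≥ 0, μ > 0 and q + 4μ < 2p. Assume the tail condition: there exist C' > 0 and k₀ with Σ_{n=k}^∞ a_n ≤ C' · σ_k^{4μ} for all k ≥ k₀. Then there exist C > 0 and λ₀ > 0 such that for all 0 < λ ≤ λ₀, the sum over the large singular values satisfies λ² · Σ_{i : σ_i^p > λ} σ_i^{q−2p} · a_i ≤ C · λ^{(q+4μ)/p}. -/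
/-- The tangent line inequality for the concave function `x ↦ x ^ α`. -/
theorem rpow_add_mul_sub_mul_rpow_le {x y α : ℝ} (hy : 0 < y) (hx : 0 < x)
    (hα₀ : 0 ≤ α) (hα₁ : α ≤ 1) :
    y ^ α + α * ((x - y) * x ^ (α - 1)) ≤ x ^ α := by
  have hB := rpow_one_add_le_one_add_mul_self (s := y / x - 1) (p := α)
    (by linarith [div_pos hy hx]) hα₀ hα₁
  rw [add_sub_cancel, Real.div_rpow hy.le hx.le, div_le_iff₀ (by positivity)] at hB
  rw [Real.rpow_sub_one hx.ne']
  have e : (1 + α * (y / x - 1)) * x ^ α = x ^ α - α * ((x - y) * (x ^ α / x)) := by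
    field_simp
    ring
  linarith

/-- Abel summation bound: increasing positive weights `x` against the increments of a sequence `T`
which is dominated by the negative power `x ^ (α - 1)`. -/
theorem sum_mul_sub_succ_add_le_rpow {x T : ℕ → ℝ} {C α : ℝ} (hx : ∀ n, 0 < x n)
    (hmono : Monotone x) (hα₀ : 0 < α) (hα₁ : α ≤ 1) (hC : 0 ≤ C)
    (hT : ∀ n, T n ≤ C * x n ^ (α - 1)) (M : ℕ) :
    ∑ i ∈ Finset.range (M + 1), x i * (T i - T (i + 1)) + x M * T (M + 1)
      ≤ C / α * x M ^ α := by
  induction M with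
  | zero =>
    have h1 := mul_le_mul_of_nonneg_left (hT 0) (hx 0).le
    have h2 : x 0 * (C * x 0 ^ (α - 1)) = C * x 0 ^ α := by
      rw [Real.rpow_sub_one (hx 0).ne']
      field_simp [(hx 0).ne']
    have h3 : C * x 0 ^ α ≤ C / α * x 0 ^ α :=
      mul_le_mul_of_nonneg_right (le_div_self hC hα₀ hα₁) (Real.rpow_nonneg (hx 0).le _)
    simp only [zero_add, Finset.sum_range_one]
    linarith
  | succ M ih =>
    rw [Finset.sum_range_succ]
    have h1 := mul_le_mul_of_nonneg_left (hT (M + 1)) (sub_nonneg.2 (hmono M.le_succ))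
    have h2 := mul_le_mul_of_nonneg_left
      (rpow_add_mul_sub_mul_rpow_le (hx M) (hx (M + 1)) hα₀.le hα₁) (div_nonneg hC hα₀.le)
    have h3 : C / α * (x M ^ α + α * ((x (M + 1) - x M) * x (M + 1) ^ (α - 1)))
        = C / α * x M ^ α + (x (M + 1) - x M) * (C * x (M + 1) ^ (α - 1)) := by
      field_simp
    simp only [Nat.succ_eq_add_one] at h1
    linarith

/-- An eventual bound by a multiple of a positive antitone sequence holds everywhere, with a larger
constant, for an antitone sequence. -/
theorem exists_forall_le_mul_of_eventually {T b : ℕ → ℝ} (hT : Antitone T) (hT₀ : ∀ n, 0 ≤ T n)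
    (hb : Antitone b) (hb₀ : ∀ n, 0 < b n) {C : ℝ} (hC : 0 < C) {k₀ : ℕ}
    (h : ∀ k, k₀ ≤ k → T k ≤ C * b k) : ∃ D > 0, ∀ k, T k ≤ D * b k := by
  have hD : 0 ≤ T 0 / b k₀ := div_nonneg (hT₀ 0) (hb₀ k₀).le
  refine ⟨C + T 0 / b k₀, by positivity, fun k => ?_⟩
  rw [add_mul]
  rcases le_total k₀ k with hk | hk
  · linarith [h k hk, mul_nonneg hD (hb₀ k).le]
  · have h1 := mul_le_mul_of_nonneg_left (hb hk) hD
    rw [div_mul_cancel₀ _ (hb₀ k₀).ne'] at h1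
    linarith [hT k.zero_le, mul_pos hC (hb₀ k)]


/-- Large-singular-value part of Lemma `lem:sumeval`: under the tail source condition and
`q + 4μ < 2p`, the sum `λ² Σ_{σ_i^p > λ} σ_i^(q-2p) a_i` is `O(λ^((q+4μ)/p))` as `λ → 0⁺`. -/
theorem large_singular_values_sum_bound
    (σ : ℕ → ℝ) (hσ_anti : Antitone σ) (hσ_pos : ∀ k, 0 < σ k) (hσ_le : ∀ k, σ k ≤ 1)
    (hσ_lim : Filter.Tendsto σ Filter.atTop (nhds 0))
    (a : ℕ → ℝ) (ha : ∀ i, 0 ≤ a i) (hsum : Summable a)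
    (p q μ : ℝ) (hp : 0 < p) (hq : 0 ≤ q) (hμ : 0 < μ) (h2 : q + 4 * μ < 2 * p)
    (htail : ∃ C' > (0 : ℝ), ∃ k₀ : ℕ, ∀ k : ℕ, k₀ ≤ k →
      ∑' n : ℕ, a (k + n) ≤ C' * σ k ^ (4 * μ)) :
    ∃ C > (0 : ℝ), ∃ lam₀ > (0 : ℝ), ∀ lam : ℝ, 0 < lam → lam ≤ lam₀ →
      lam ^ 2 * ∑' i : ℕ, (if lam < σ i ^ p then σ i ^ (q - 2 * p) * a i else 0)
        ≤ C * lam ^ ((q + 4 * μ) / p) := by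

  obtain ⟨C', hC', k₀, htail⟩ := htail
  set T : ℕ → ℝ := fun k => ∑' n, a (k + n) with hTdef
  have hsumk : ∀ k, Summable fun n => a (k + n) := fun k =>
    hsum.comp_injective (add_right_injective k)
  have hT₀ : ∀ k, 0 ≤ T k := fun k => tsum_nonneg fun n => ha _
  have hTsucc : ∀ k, T k = a k + T (k + 1) := fun k => by
    simp only [hTdef]
    rw [(hsumk k).tsum_eq_zero_add, add_zero]
    simp only [add_assoc, add_comm 1]
  have hTanti : Antitone T := antitone_nat_of_succ_le fun k => by linarith [hTsucc k, ha k]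
  obtain ⟨D, hD, hTD⟩ := exists_forall_le_mul_of_eventually hTanti hT₀
    (fun i j hij => Real.rpow_le_rpow (hσ_pos j).le (hσ_anti hij) (by positivity : 0 ≤ 4 * μ))
    (fun n => Real.rpow_pos_of_pos (hσ_pos n) _) hC' htail
  have hs : q - 2 * p < 0 := by linarith
  set α := (q + 4 * μ - 2 * p) / (q - 2 * p) with hα
  have hα₀ : 0 < α := div_pos_of_neg_of_neg (by linarith) hs
  have hα₁ : α ≤ 1 := by
    rw [hα, div_le_one_of_neg hs]
    linarith
  have hsα : (q - 2 * p) * α = q + 4 * μ - 2 * p := mul_div_cancel₀ _ hs.ne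
  have key := sum_mul_sub_succ_add_le_rpow (x := fun n => σ n ^ (q - 2 * p)) (T := T)
    (fun n => Real.rpow_pos_of_pos (hσ_pos n) _)
    (fun i j hij => Real.rpow_le_rpow_of_nonpos (hσ_pos j) (hσ_anti hij) hs.le)
    hα₀ hα₁ hD.le (fun n => by
      rw [← Real.rpow_mul (hσ_pos n).le, mul_sub, hsα]
      convert hTD n using 3
      ring)
  refine ⟨D / α, div_pos hD hα₀, 1, one_pos, fun lam hlam _ => ?_⟩
  have hex : ∃ N, σ N ^ p ≤ lam := by
    have h := hσ_lim.rpow_const (p := p) (Or.inr hp.le)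
    rw [Real.zero_rpow hp.ne'] at h
    exact (h.eventually_le_const hlam).exists
  classical
  obtain ⟨N, hN, hmin⟩ : ∃ N, σ N ^ p ≤ lam ∧ ∀ m < N, lam < σ m ^ p :=
    ⟨Nat.find hex, Nat.find_spec hex, fun m hm => not_le.1 (Nat.find_min hex hm)⟩
  have htsum : ∑' i, (if lam < σ i ^ p then σ i ^ (q - 2 * p) * a i else 0)
      = ∑ i ∈ Finset.range N, σ i ^ (q - 2 * p) * (T i - T (i + 1)) := by
    rw [tsum_eq_sum (s := Finset.range N)]
    · refine Finset.sum_congr rfl fun i hi => ?_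
      rw [if_pos (hmin i (Finset.mem_range.1 hi)), hTsucc i, add_sub_cancel_right]
    · intro i hi
      refine if_neg (not_lt.2 (le_trans ?_ hN))
      exact Real.rpow_le_rpow (hσ_pos i).le (hσ_anti (by simpa using hi)) hp.le
  rw [htsum]
  rcases N with _ | M
  · rw [Finset.sum_range_zero, mul_zero]
    positivity
  have hlarge : (σ M ^ (q - 2 * p)) ^ α ≤ lam ^ ((q + 4 * μ - 2 * p) / p) := by
    have h := Real.rpow_le_rpow_of_nonpos hlam (hmin M M.lt_succ_self).le
      (div_nonpos_of_nonpos_of_nonneg (by linarith) hp.le : (q + 4 * μ - 2 * p) / p ≤ 0)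
    rwa [← Real.rpow_mul (hσ_pos M).le, mul_div_cancel₀ _ hp.ne', ← hsα,
      Real.rpow_mul (hσ_pos M).le, hsα] at h
  have hpos : 0 ≤ σ M ^ (q - 2 * p) * T (M + 1) :=
    mul_nonneg (Real.rpow_nonneg (hσ_pos M).le _) (hT₀ _)
  have hsplit : lam ^ 2 * lam ^ ((q + 4 * μ - 2 * p) / p) = lam ^ ((q + 4 * μ) / p) := by
    rw [← Real.rpow_natCast, ← Real.rpow_add hlam]
    congr 1
    push_cast
    field_simp
    ring
  calc lam ^ 2 * ∑ i ∈ Finset.range (M + 1), σ i ^ (q - 2 * p) * (T i - T (i + 1))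
      ≤ lam ^ 2 * (D / α * lam ^ ((q + 4 * μ - 2 * p) / p)) := by
        gcongr
        have := mul_le_mul_of_nonneg_left hlarge (div_nonneg hD.le hα₀.le)
        linarith [key M]
    _ = D / α * lam ^ ((q + 4 * μ) / p) := by rw [← hsplit]; ring
end

section
/- Let σ : ℕ → ℝ be a nonincreasing sequence with 0 < σ_k ≤ 1 for all k, let a : ℕ → ℝ be nonnegative and summable, and let p, q, μ be real numbers with q + 4μ − 2p < 0. Assume there exist C' > 0 and k₀ with Σ_{n=k}^∞ a_n ≤ C' · σ_k^{4μ} for all k ≥ k₀. Then there exists C > 0 such that the partial sums satisfy Σ_{i=1}^{k} σ_i^{q−2p} · a_i ≤ C · σ_k^{q+4μ−2p} for all k ≥ 1. -/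
/-- Tangent-line bound for the concave power `t ↦ t ^ (r / s)`, evaluated at `x ^ s` and `y ^ s`. -/
lemma rpow_sub_rpow_mul_le {x y r s : ℝ} (hx : 0 < x) (hy : 0 < y) (hs : s < 0)
    (hr : r < 0) (hsr : s ≤ r) :
    (x ^ s - y ^ s) * x ^ (r - s) ≤ s / r * (x ^ r - y ^ r) := by
  have hθ : 0 < r / s := div_pos_of_neg_of_neg hr hs
  have hθ1 : r / s ≤ 1 := (div_le_one_of_neg hs).2 hsr
  have amgm := Real.geom_mean_le_arith_mean2_weighted hθ.le (sub_nonneg.2 hθ1)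
    (Real.rpow_nonneg hy.le s) (Real.rpow_nonneg hx.le s) (by ring)
  rw [← Real.rpow_mul hy.le, ← Real.rpow_mul hx.le, mul_div_cancel₀ r hs.ne,
    show s * (1 - r / s) = s - r by field_simp [hs.ne]] at amgm
  have scaled := mul_le_mul_of_nonneg_right amgm (Real.rpow_nonneg hx.le (r - s))
  have cancel : x ^ (s - r) * x ^ (r - s) = 1 := by
    rw [← Real.rpow_add hx]; simp
  have combine : x ^ s * x ^ (r - s) = x ^ r := by
    rw [← Real.rpow_add hx]; congr 1; ring
  have key : r / s * ((x ^ s - y ^ s) * x ^ (r - s)) ≤ x ^ r - y ^ r := by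
    linear_combination scaled - y ^ r * cancel + combine
  calc (x ^ s - y ^ s) * x ^ (r - s)
      = s / r * (r / s * ((x ^ s - y ^ s) * x ^ (r - s))) := by
        field_simp [hs.ne, hr.ne]
    _ ≤ s / r * (x ^ r - y ^ r) :=
        mul_le_mul_of_nonneg_left key (div_pos_of_neg_of_neg hs hr).le

/-- Summation by parts: if the tails `T` are `O(σ ^ (r - s))`, then the sums of `σ ^ s` against
the increments of `T` are `O(σ ^ r)`. -/
lemma sum_rpow_mul_sub_add_le {σ T : ℕ → ℝ} {r s C : ℝ} (hσ_anti : Antitone σ)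
    (hσ_pos : ∀ k, 0 < σ k) (hs : s < 0) (hr : r < 0) (hsr : s ≤ r) (hC : 0 ≤ C)
    (hT : ∀ k, T k ≤ C * σ k ^ (r - s)) (k : ℕ) :
    ∑ i ∈ Finset.range (k + 1), σ i ^ s * (T i - T (i + 1)) + σ k ^ s * T (k + 1)
      ≤ C * (s / r) * σ k ^ r := by
  induction k with
  | zero =>
    have h1 : 1 ≤ s / r := (one_le_div_of_neg hr).2 hsr
    calc _ = σ 0 ^ s * T 0 := by simp; ring
      _ ≤ σ 0 ^ s * (C * σ 0 ^ (r - s)) :=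
          mul_le_mul_of_nonneg_left (hT 0) (Real.rpow_nonneg (hσ_pos 0).le s)
      _ = C * 1 * σ 0 ^ r := by
          rw [mul_left_comm, ← Real.rpow_add (hσ_pos 0), add_sub_cancel, mul_one]
      _ ≤ C * (s / r) * σ 0 ^ r := by
          have := Real.rpow_nonneg (hσ_pos 0).le r
          gcongr
  | succ k ih =>
    rw [Finset.sum_range_succ]
    have hmono : σ k ^ s ≤ σ (k + 1) ^ s :=
      Real.rpow_le_rpow_of_nonpos (hσ_pos _) (hσ_anti k.le_succ) hs.le
    have tail := mul_le_mul_of_nonneg_left (hT (k + 1)) (sub_nonneg.2 hmono)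
    have step := mul_le_mul_of_nonneg_left
      (rpow_sub_rpow_mul_le (hσ_pos (k + 1)) (hσ_pos k) hs hr hsr) hC
    linear_combination ih + tail + step

/-- An eventual power bound on an antitone sequence `T` holds for all indices, after enlarging
the constant. -/
lemma exists_forall_le_mul_rpow {σ T : ℕ → ℝ} {t C : ℝ} {k₀ : ℕ} (hσ_anti : Antitone σ)
    (hσ_pos : ∀ k, 0 < σ k) (hT_anti : Antitone T) (hT : ∀ k, 0 ≤ T k) (ht : 0 ≤ t) (hC : 0 < C)
    (h : ∀ k, k₀ ≤ k → T k ≤ C * σ k ^ t) : ∃ D > (0 : ℝ), ∀ k, T k ≤ D * σ k ^ t := by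
  have hpos : 0 < σ k₀ ^ t := Real.rpow_pos_of_pos (hσ_pos _) _
  have hq : 0 ≤ T 0 / σ k₀ ^ t := div_nonneg (hT 0) hpos.le
  refine ⟨C + T 0 / σ k₀ ^ t, by positivity, fun k => ?_⟩
  have hk : 0 < σ k ^ t := Real.rpow_pos_of_pos (hσ_pos _) _
  rw [add_mul]
  rcases le_total k₀ k with hle | hle
  · exact (h k hle).trans (le_add_of_nonneg_right (mul_nonneg hq hk.le))
  · have hσt : σ k₀ ^ t ≤ σ k ^ t := Real.rpow_le_rpow (hσ_pos _).le (hσ_anti hle) ht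
    calc T k ≤ T 0 := hT_anti k.zero_le
      _ = T 0 / σ k₀ ^ t * σ k₀ ^ t := (div_mul_cancel₀ _ hpos.ne').symm
      _ ≤ T 0 / σ k₀ ^ t * σ k ^ t := mul_le_mul_of_nonneg_left hσt hq
      _ ≤ C * σ k ^ t + T 0 / σ k₀ ^ t * σ k ^ t := le_add_of_nonneg_left (by positivity)

/-- If `r ≤ s` and `r ≤ 0`, summability of `a` alone bounds the partial sums by `σ ^ r`. -/
lemma sum_rpow_mul_le_tsum_mul {σ a : ℕ → ℝ} {r s : ℝ} (hσ_anti : Antitone σ)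
    (hσ_pos : ∀ k, 0 < σ k) (hσ_le : ∀ k, σ k ≤ 1) (ha : ∀ i, 0 ≤ a i) (hsum : Summable a)
    (hr : r ≤ 0) (hrs : r ≤ s) (k : ℕ) :
    ∑ i ∈ Finset.range (k + 1), σ i ^ s * a i ≤ (∑' i, a i) * σ k ^ r := by
  calc ∑ i ∈ Finset.range (k + 1), σ i ^ s * a i
      ≤ ∑ i ∈ Finset.range (k + 1), σ k ^ r * a i := by
        refine Finset.sum_le_sum fun i hi => mul_le_mul_of_nonneg_right ?_ (ha i)
        exact (Real.rpow_le_rpow_of_exponent_ge (hσ_pos i) (hσ_le i) hrs).trans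
          (Real.rpow_le_rpow_of_nonpos (hσ_pos k)
            (hσ_anti (Nat.lt_succ_iff.1 (Finset.mem_range.1 hi))) hr)
    _ = (∑ i ∈ Finset.range (k + 1), a i) * σ k ^ r := by rw [← Finset.mul_sum, mul_comm]
    _ ≤ (∑' i, a i) * σ k ^ r :=
        mul_le_mul_of_nonneg_right (hsum.sum_le_tsum _ fun i _ => ha i)
          (Real.rpow_nonneg (hσ_pos k).le r)

/-- Appendix induction lemma: under the tail source condition and `q + 4μ - 2p < 0`, the partial
sums `Σ_{i=0}^{k} σ_i^(q-2p) a_i` are `O(σ_k^(q+4μ-2p))`. -/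
theorem partial_sum_negative_power_bound
    (σ : ℕ → ℝ) (hσ_anti : Antitone σ) (hσ_pos : ∀ k, 0 < σ k) (hσ_le : ∀ k, σ k ≤ 1)
    (a : ℕ → ℝ) (ha : ∀ i, 0 ≤ a i) (hsum : Summable a)
    (p q μ : ℝ) (hpqμ : q + 4 * μ - 2 * p < 0)
    (htail : ∃ C' > (0 : ℝ), ∃ k₀ : ℕ, ∀ k : ℕ, k₀ ≤ k →
      ∑' n : ℕ, a (k + n) ≤ C' * σ k ^ (4 * μ)) :
    ∃ C > (0 : ℝ), ∀ k : ℕ,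
      ∑ i ∈ Finset.range (k + 1), σ i ^ (q - 2 * p) * a i
        ≤ C * σ k ^ (q + 4 * μ - 2 * p) := by
  obtain hμ | hμ := le_or_gt μ 0
  · refine ⟨∑' i, a i + 1, add_pos_of_nonneg_of_pos (tsum_nonneg ha) one_pos, fun k => ?_⟩
    refine (sum_rpow_mul_le_tsum_mul hσ_anti hσ_pos hσ_le ha hsum hpqμ.le (by linarith) k).trans ?_
    exact mul_le_mul_of_nonneg_right (le_add_of_nonneg_right zero_le_one)
      (Real.rpow_nonneg (hσ_pos k).le _)
  obtain ⟨C', hC', k₀, htail⟩ := htail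
  set T : ℕ → ℝ := fun k => ∑' n, a (k + n) with hT_def
  have hT_nonneg : ∀ k, 0 ≤ T k := fun k => tsum_nonneg fun n => ha _
  have hT_succ : ∀ k, T k - T (k + 1) = a k := by
    intro k
    have hk : Summable fun n => a (k + n) := by
      simpa only [add_comm k] using (summable_nat_add_iff k).2 hsum
    have := hk.tsum_eq_zero_add
    simp only [hT_def, this, add_zero, add_assoc, add_comm 1, add_sub_cancel_right]
  have hT_anti : Antitone T := antitone_nat_of_succ_le fun k => by
    linarith [hT_succ k, ha k]
  obtain ⟨D, hD, hTD⟩ := exists_forall_le_mul_rpow hσ_anti hσ_pos hT_anti hT_nonneg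
    (by positivity : 0 ≤ 4 * μ) hC' htail
  have hs : q - 2 * p < 0 := by linarith
  refine ⟨D * ((q - 2 * p) / (q + 4 * μ - 2 * p)),
    mul_pos hD (div_pos_of_neg_of_neg hs hpqμ), fun k => ?_⟩
  have bound := sum_rpow_mul_sub_add_le (T := T) hσ_anti hσ_pos hs hpqμ (by linarith) hD.le
    (fun k => by
      rw [show q + 4 * μ - 2 * p - (q - 2 * p) = 4 * μ by ring]
      exact hTD k) k
  simp only [hT_succ] at bound
  exact (le_add_of_nonneg_right
    (mul_nonneg (Real.rpow_nonneg (hσ_pos k).le _) (hT_nonneg _))).trans bound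
end

section
/- Let X, Y be Hilbert spaces, A : X → Y a bounded linear operator, {v_i}_{i∈ℕ} an orthonormal family in X, {u_i}_{i∈ℕ} an orthonormal family in Y, and σ : ℕ → ℝ a nonincreasing sequence with 0 < σ_i ≤ 1, σ_i → 0, A v_i = σ_i u_i and A* u_i = σ_i v_i for all i. Let x† ∈ X lie in the closed span of {v_i}. Let ν ≥ 0 and μ > 0 satisfy 0 < μ + ν < 1 and 4ν + 4μ > 0. Then there exist C > 0 and α₀ > 0 such that Σ_{i=1}^∞ (σ_i^{4ν} · α² / (σ_i² + α)²) · ⟨x†, v_i⟩² ≤ C · α^{2(ν+μ)} for all 0 < α ≤ α₀, if and only if there exist C' > 0 and k₀ with Σ_{n=k}^∞ ⟨x†, v_n⟩² ≤ C' · σ_k^{4μ} for all k ≥ k₀. -/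
open scoped RealInnerProductSpace

open Classical in
/-- If a finite family is exhausted by layers whose sums decay geometrically, its total sum is
bounded by the geometric series. -/
theorem sum_le_of_layers_le_geometric {ι : Type*} (F : Finset ι) (f : ι → ℝ)
    (hf : ∀ i ∈ F, 0 ≤ f i) (P : ℕ → ι → Prop) (h_zero : ∀ i ∈ F, P 0 i)
    (h_end : ∃ N, ∀ i ∈ F, ¬ P N i) {L r : ℝ} (hL : 0 ≤ L) (hr : 0 ≤ r) (hr1 : r < 1)
    (h_layer : ∀ j, ∑ i ∈ F with (P j i ∧ ¬ P (j + 1) i), f i ≤ L * r ^ j) :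
    ∑ i ∈ F, f i ≤ L * (1 - r)⁻¹ := by
  have step : ∀ j, ∑ i ∈ F with P j i, f i ≤ L * r ^ j + ∑ i ∈ F with P (j + 1) i, f i := by
    intro j
    refine le_trans ?_ (add_le_add_left (h_layer j) _)
    simp only [Finset.sum_filter]
    rw [← Finset.sum_add_distrib]
    refine Finset.sum_le_sum fun i hi => ?_
    have := hf i hi
    by_cases h1 : P j i <;> by_cases h2 : P (j + 1) i <;> simp [h1, h2, this]
  have partial_sum : ∀ n, ∑ i ∈ F, f i
      ≤ L * ∑ j ∈ Finset.range n, r ^ j + ∑ i ∈ F with P n i, f i := by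
    intro n
    induction n with
    | zero => simp [Finset.filter_true_of_mem h_zero]
    | succ n ih =>
      rw [Finset.sum_range_succ, mul_add]
      linarith [step n]
  obtain ⟨N, hN⟩ := h_end
  refine (partial_sum N).trans ?_
  rw [Finset.filter_false_of_mem hN, Finset.sum_empty, add_zero, ← tsum_geometric_of_lt_one hr hr1]
  exact mul_le_mul_of_nonneg_left
    ((summable_geometric_of_lt_one hr hr1).sum_le_tsum _ fun _ _ => pow_nonneg hr _) hL

/-- A power bound for the tails of a series turns into a power bound for the mass that a finite
set carries below a given level. -/
theorem sum_le_of_tail_le {s b : ℕ → ℝ} (hs_pos : ∀ i, 0 < s i) (hb : ∀ i, 0 ≤ b i)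
    (hb_sum : Summable b) {q D : ℝ} (hq : 0 ≤ q) (hD : 0 ≤ D)
    (h : ∀ k, ∑' n, b (k + n) ≤ D * s k ^ q) (F : Finset ℕ) {β : ℝ} (hβ : 0 ≤ β)
    (hF : ∀ i ∈ F, s i ≤ β) : ∑ i ∈ F, b i ≤ D * β ^ q := by
  rcases F.eq_empty_or_nonempty with rfl | hne
  · simpa using mul_nonneg hD (Real.rpow_nonneg hβ q)
  set k := F.min' hne with hk
  have h_tail : Summable fun n => b (k + n) := hb_sum.comp_injective (add_right_injective k)
  have h_image : ∑ i ∈ F, b i = ∑ n ∈ F.image (· - k), b (k + n) := by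
    rw [Finset.sum_image]
    · refine Finset.sum_congr rfl fun i hi => ?_
      rw [Nat.add_sub_cancel' (F.min'_le i hi)]
    · intro i hi j hj hij
      have h1 := F.min'_le i hi
      have h2 := F.min'_le j hj
      simp only at hij
      omega
  calc ∑ i ∈ F, b i ≤ ∑' n, b (k + n) := by
        rw [h_image]
        exact h_tail.sum_le_tsum _ fun _ _ => hb _
    _ ≤ D * s k ^ q := h k
    _ ≤ D * β ^ q := by
        gcongr
        · exact (hs_pos k).le
        · exact hF k (F.min'_mem hne)

/-- A tail bound valid from some index on holds for all indices, with a larger constant. -/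
theorem exists_forall_tail_le {s b : ℕ → ℝ} (hs_anti : Antitone s) (hs_pos : ∀ i, 0 < s i)
    (hb : ∀ i, 0 ≤ b i) (hb_sum : Summable b) {q D : ℝ} (hq : 0 ≤ q) (hD : 0 < D) {k₀ : ℕ}
    (h : ∀ k, k₀ ≤ k → ∑' n, b (k + n) ≤ D * s k ^ q) :
    ∃ D' > 0, ∀ k, ∑' n, b (k + n) ≤ D' * s k ^ q := by
  have hB : 0 ≤ ∑' n, b n := tsum_nonneg hb
  have hk₀ : 0 < s k₀ ^ q := Real.rpow_pos_of_pos (hs_pos _) _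
  refine ⟨D + (∑' n, b n) / s k₀ ^ q, by positivity, fun k => ?_⟩
  have hk : 0 < s k ^ q := Real.rpow_pos_of_pos (hs_pos _) _
  rcases le_total k₀ k with hle | hle
  · refine (h k hle).trans ?_
    gcongr
    exact le_add_of_nonneg_right (by positivity)
  · have h1 : ∑' n, b (k + n) ≤ ∑' n, b n :=
      tsum_comp_le_tsum_of_inj hb_sum hb (add_right_injective k)
    have h2 : s k₀ ^ q ≤ s k ^ q := Real.rpow_le_rpow (hs_pos _).le (hs_anti hle) hq
    have h3 : ∑' n, b n = (∑' n, b n) / s k₀ ^ q * s k₀ ^ q := by field_simp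
    calc ∑' n, b (k + n) ≤ (∑' n, b n) / s k₀ ^ q * s k₀ ^ q := h1.trans h3.le
      _ ≤ (∑' n, b n) / s k₀ ^ q * s k ^ q := by gcongr
      _ ≤ _ := by gcongr; exact le_add_of_nonneg_left hD.le

theorem summable_tikhonov_residual {s b : ℕ → ℝ} (hs_anti : Antitone s) (hs_pos : ∀ i, 0 < s i)
    (hb : ∀ i, 0 ≤ b i) (hb_sum : Summable b) {p α : ℝ} (hp : 0 ≤ p) (hα : 0 < α) :
    Summable fun i => s i ^ p * α ^ 2 / (s i + α) ^ 2 * b i := by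
  refine Summable.of_nonneg_of_le (fun i => ?_) (fun i => ?_) (hb_sum.mul_left (s 0 ^ p))
  · have := hs_pos i
    have := hb i
    positivity
  · have hi := hs_pos i
    refine mul_le_mul_of_nonneg_right ?_ (hb i)
    rw [div_le_iff₀ (by positivity)]
    have h1 : s i ^ p ≤ s 0 ^ p := Real.rpow_le_rpow hi.le (hs_anti (Nat.zero_le i)) hp
    have h2 : α ^ 2 ≤ (s i + α) ^ 2 := by gcongr; linarith
    have h3 : 0 ≤ s 0 ^ p := Real.rpow_nonneg (hs_pos 0).le p
    gcongr

theorem tail_le_of_tikhonov_residual_le {s b : ℕ → ℝ} (hs_anti : Antitone s)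
    (hs_pos : ∀ i, 0 < s i) (hb : ∀ i, 0 ≤ b i) (hb_sum : Summable b) {p q C α₀ : ℝ}
    (hp : 0 ≤ p) (hq : 0 < q) (hC : 0 < C)
    (h : ∀ α, 0 < α → α ≤ α₀ →
      ∑' i, s i ^ p * α ^ 2 / (s i + α) ^ 2 * b i ≤ C * α ^ (p + q))
    {k : ℕ} (hk : s k ≤ α₀) :
    ∑' n, b (k + n) ≤ 4 * 2 ^ p * C * (1 - (2⁻¹ : ℝ) ^ q)⁻¹ * s k ^ q := by
  classical
  have hsk := hs_pos k
  refine Real.tsum_le_of_sum_range_le (fun _ => hb _) fun N => ?_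
  have key := sum_le_of_layers_le_geometric (Finset.range N) (fun n => b (k + n))
    (fun _ _ => hb _) (fun j n => s (k + n) ≤ s k * 2⁻¹ ^ j)
    (fun n _ => by simpa using hs_anti (Nat.le_add_right k n)) ?_
    (L := 4 * 2 ^ p * C * s k ^ q) (r := (2⁻¹ : ℝ) ^ q) (by positivity) (by positivity)
    (Real.rpow_lt_one (by norm_num) (by norm_num) hq) ?_
  · exact key.trans_eq (by ring)
  · obtain ⟨j, hj⟩ := exists_pow_lt_of_lt_one (div_pos (hs_pos (k + N)) hsk)
      (show (2⁻¹ : ℝ) < 1 by norm_num)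
    refine ⟨j, fun n hn => not_le.2 ?_⟩
    have h1 : s (k + N) ≤ s (k + n) := hs_anti (by have := Finset.mem_range.1 hn; omega)
    rw [lt_div_iff₀ hsk] at hj
    linarith
  · intro j
    set β := s k * 2⁻¹ ^ j with hβ_def
    have hβ : 0 < β := by positivity
    have hβ_le : β ≤ α₀ :=
      (mul_le_of_le_one_right hsk.le (pow_le_one₀ (by norm_num) (by norm_num))).trans hk
    have hβp : 0 < β ^ p := Real.rpow_pos_of_pos hβ p
    have h_summable := summable_tikhonov_residual hs_anti hs_pos hb hb_sum hp hβ
    have h_nonneg : ∀ i, 0 ≤ s i ^ p * β ^ 2 / (s i + β) ^ 2 * b i := fun i => by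
      have := hs_pos i
      have := hb i
      positivity
    have h_term : ∀ n, s (k + n) ≤ β → β * 2⁻¹ < s (k + n) →
        b (k + n) ≤ 4 * 2 ^ p / β ^ p *
          (s (k + n) ^ p * β ^ 2 / (s (k + n) + β) ^ 2 * b (k + n)) := by
      intro n h1 h2
      have hi := hs_pos (k + n)
      have h3 : β ^ p / 2 ^ p ≤ s (k + n) ^ p := by
        rw [← Real.div_rpow hβ.le (by norm_num)]
        exact Real.rpow_le_rpow (by positivity) (by linarith) hp
      have h4 : 1 / 4 ≤ β ^ 2 / (s (k + n) + β) ^ 2 := by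
        rw [div_le_div_iff₀ (by norm_num) (by positivity)]
        nlinarith
      have h5 : β ^ p / 2 ^ p * (1 / 4) ≤ s (k + n) ^ p * (β ^ 2 / (s (k + n) + β) ^ 2) := by
        gcongr
      calc b (k + n) = 4 * 2 ^ p / β ^ p * (β ^ p / 2 ^ p * (1 / 4) * b (k + n)) := by
            field_simp
        _ ≤ 4 * 2 ^ p / β ^ p *
            (s (k + n) ^ p * (β ^ 2 / (s (k + n) + β) ^ 2) * b (k + n)) := by
            have := hb (k + n)
            gcongr
        _ = _ := by rw [mul_div_assoc (s (k + n) ^ p)]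
    calc ∑ n ∈ Finset.range N with
          (s (k + n) ≤ β ∧ ¬ s (k + n) ≤ s k * 2⁻¹ ^ (j + 1)), b (k + n)
        ≤ ∑ n ∈ Finset.range N with
          (s (k + n) ≤ β ∧ ¬ s (k + n) ≤ s k * 2⁻¹ ^ (j + 1)), 4 * 2 ^ p / β ^ p *
          (s (k + n) ^ p * β ^ 2 / (s (k + n) + β) ^ 2 * b (k + n)) := by
          refine Finset.sum_le_sum fun n hn => ?_
          obtain ⟨-, h1, h2⟩ := Finset.mem_filter.1 hn
          refine h_term n h1 ?_
          rw [hβ_def, mul_assoc, ← pow_succ]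
          exact not_le.1 h2
      _ ≤ 4 * 2 ^ p / β ^ p * (C * β ^ (p + q)) := by
          rw [← Finset.mul_sum]
          refine mul_le_mul_of_nonneg_left (le_trans ?_ (h β hβ hβ_le)) (by positivity)
          exact ((h_summable.comp_injective (add_right_injective k)).sum_le_tsum _
            fun _ _ => h_nonneg _).trans
            (tsum_comp_le_tsum_of_inj h_summable h_nonneg (add_right_injective k))
      _ = 4 * 2 ^ p * C * β ^ q := by
          rw [Real.rpow_add hβ]
          field_simp
      _ = 4 * 2 ^ p * C * s k ^ q * ((2⁻¹ : ℝ) ^ q) ^ j := by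
          rw [hβ_def, Real.mul_rpow hsk.le (by positivity), Real.rpow_pow_comm (by norm_num)]
          ring

theorem tikhonov_residual_le_of_tail_le {s b : ℕ → ℝ} (hs_anti : Antitone s)
    (hs_pos : ∀ i, 0 < s i) (hb : ∀ i, 0 ≤ b i) (hb_sum : Summable b) {p q D : ℝ}
    (hp : 0 ≤ p) (hq : 0 ≤ q) (hpq : p + q < 2) (hD : 0 ≤ D)
    (h : ∀ k, ∑' n, b (k + n) ≤ D * s k ^ q) {α : ℝ} (hα : 0 < α) :
    ∑' i, s i ^ p * α ^ 2 / (s i + α) ^ 2 * b i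
      ≤ (D + 2 ^ (p + q) * D * (1 - (2 : ℝ) ^ (p + q - 2))⁻¹) * α ^ (p + q) := by
  classical
  have h_nonneg : ∀ i, 0 ≤ s i ^ p * α ^ 2 / (s i + α) ^ 2 * b i := fun i => by
    have := hs_pos i
    have := hb i
    positivity
  have h_mass := fun F {β : ℝ} => sum_le_of_tail_le hs_pos hb hb_sum hq hD h F (β := β)
  refine Real.tsum_le_of_sum_range_le h_nonneg fun N => ?_
  rw [← Finset.sum_filter_add_sum_filter_not (Finset.range N) (fun i => s i ≤ α), add_mul]
  refine add_le_add ?_ ?_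
  · calc ∑ i ∈ Finset.range N with s i ≤ α, s i ^ p * α ^ 2 / (s i + α) ^ 2 * b i
        ≤ ∑ i ∈ Finset.range N with s i ≤ α, α ^ p * b i := by
          refine Finset.sum_le_sum fun i hi => mul_le_mul_of_nonneg_right ?_ (hb i)
          have hsi := hs_pos i
          rw [div_le_iff₀ (by positivity)]
          have h1 : s i ^ p ≤ α ^ p :=
            Real.rpow_le_rpow hsi.le (Finset.mem_filter.1 hi).2 hp
          have h2 : α ^ 2 ≤ (s i + α) ^ 2 := by gcongr; linarith
          gcongr
      _ ≤ α ^ p * (D * α ^ q) := by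
          rw [← Finset.mul_sum]
          exact mul_le_mul_of_nonneg_left
            (h_mass _ hα.le fun i hi => (Finset.mem_filter.1 hi).2) (by positivity)
      _ = D * α ^ (p + q) := by rw [Real.rpow_add hα]; ring
  · refine (sum_le_of_layers_le_geometric _ _ (fun i _ => h_nonneg i)
      (fun j i => α * 2 ^ j < s i) (fun i hi => by simpa using (Finset.mem_filter.1 hi).2) ?_
      (L := 2 ^ (p + q) * D * α ^ (p + q)) (r := (2 : ℝ) ^ (p + q - 2)) (by positivity)
      (by positivity) (Real.rpow_lt_one_of_one_lt_of_neg (by norm_num) (by linarith))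
      ?_).trans_eq (by ring)
    · obtain ⟨j, hj⟩ := pow_unbounded_of_one_lt (s 0 / α) (show (1 : ℝ) < 2 by norm_num)
      refine ⟨j, fun i _ => not_lt.2 ((hs_anti (Nat.zero_le i)).trans ?_)⟩
      rw [div_lt_iff₀ hα] at hj
      linarith
    · intro j
      set γ := α * 2 ^ j with hγ_def
      have hγ : 0 < γ := by positivity
      have hγ_succ : α * 2 ^ (j + 1) = 2 * γ := by rw [hγ_def, pow_succ]; ring
      rw [hγ_succ]
      set F := {i ∈ {i ∈ Finset.range N | ¬ s i ≤ α} | γ < s i ∧ ¬ 2 * γ < s i} with hF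
      have hF_mem : ∀ i ∈ F, γ < s i ∧ s i ≤ 2 * γ := fun i hi => by
        obtain ⟨-, h1, h2⟩ := Finset.mem_filter.1 hi
        exact ⟨h1, not_lt.1 h2⟩
      calc ∑ i ∈ F, s i ^ p * α ^ 2 / (s i + α) ^ 2 * b i
          ≤ ∑ i ∈ F, (2 * γ) ^ p * α ^ 2 / γ ^ 2 * b i := by
            refine Finset.sum_le_sum fun i hi => mul_le_mul_of_nonneg_right ?_ (hb i)
            obtain ⟨h1, h2⟩ := hF_mem i hi
            have h3 : s i ^ p ≤ (2 * γ) ^ p := Real.rpow_le_rpow (hs_pos i).le h2 hp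
            have h4 : γ ≤ s i + α := by linarith
            gcongr
        _ ≤ (2 * γ) ^ p * α ^ 2 / γ ^ 2 * (D * (2 * γ) ^ q) := by
            rw [← Finset.mul_sum]
            exact mul_le_mul_of_nonneg_left
              (h_mass F (by positivity) fun i hi => (hF_mem i hi).2) (by positivity)
        _ = 2 ^ (p + q) * D * α ^ 2 * γ ^ (p + q - 2) := by
            rw [Real.rpow_sub hγ, Real.rpow_two, Real.mul_rpow (by norm_num) hγ.le,
              Real.mul_rpow (by norm_num) hγ.le, Real.rpow_add hγ,
              Real.rpow_add (by norm_num : (0 : ℝ) < 2)]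
            ring
        _ = 2 ^ (p + q) * D * α ^ (p + q) * ((2 : ℝ) ^ (p + q - 2)) ^ j := by
            rw [hγ_def, Real.mul_rpow hα.le (by positivity), Real.rpow_pow_comm (by norm_num),
              Real.rpow_sub hα, Real.rpow_two]
            field_simp

/-- Theorem `thm:conv` (converse result): for Tikhonov regularization with exact data, the decay
rate `‖(A*A)^ν (x_α - x†)‖² = O(α^(2(ν+μ)))`, written spectrally, is equivalent to the tail-sum
form of the Hölder source condition with parameter `μ`. -/
theorem converse_result_spectral
    {X Y : Type*} [NormedAddCommGroup X] [InnerProductSpace ℝ X] [CompleteSpace X]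
    [NormedAddCommGroup Y] [InnerProductSpace ℝ Y] [CompleteSpace Y]
    (A : X →L[ℝ] Y) (v : ℕ → X) (u : ℕ → Y)
    (hv : Orthonormal ℝ v) (hu : Orthonormal ℝ u)
    (σ : ℕ → ℝ) (hσ_anti : Antitone σ) (hσ_pos : ∀ i, 0 < σ i) (hσ_le : ∀ i, σ i ≤ 1)
    (hσ_lim : Filter.Tendsto σ Filter.atTop (nhds 0))
    (hAv : ∀ i, A (v i) = σ i • u i)
    (hAu : ∀ i, (ContinuousLinearMap.adjoint A) (u i) = σ i • v i)
    (xdag : X) (hxdag : xdag ∈ (Submodule.span ℝ (Set.range v)).topologicalClosure)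
    (ν μ : ℝ) (hν : 0 ≤ ν) (hμ : 0 < μ) (hμν : μ + ν < 1) (hμν' : 0 < 4 * ν + 4 * μ) :
    (∃ C > (0 : ℝ), ∃ α₀ > (0 : ℝ), ∀ α : ℝ, 0 < α → α ≤ α₀ →
        ∑' i : ℕ, σ i ^ (4 * ν) * α ^ 2 / (σ i ^ 2 + α) ^ 2 * ⟪xdag, v i⟫ ^ 2
          ≤ C * α ^ (2 * (ν + μ)))
      ↔ (∃ C' > (0 : ℝ), ∃ k₀ : ℕ, ∀ k : ℕ, k₀ ≤ k →
          ∑' n : ℕ, ⟪xdag, v (k + n)⟫ ^ 2 ≤ C' * σ k ^ (4 * μ)) := by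
  have hs_anti : Antitone fun i => σ i ^ 2 := fun i j hij =>
    pow_le_pow_left₀ (hσ_pos j).le (hσ_anti hij) 2
  have hs_pos : ∀ i, 0 < σ i ^ 2 := fun i => pow_pos (hσ_pos i) 2
  have hb : ∀ i, 0 ≤ ⟪xdag, v i⟫ ^ 2 := fun i => sq_nonneg _
  have hb_sum : Summable fun i => ⟪xdag, v i⟫ ^ 2 := by
    simpa [real_inner_comm] using hv.inner_products_summable xdag
  have h_rpow : ∀ (i : ℕ) (t : ℝ), σ i ^ (4 * t) = (σ i ^ 2) ^ (2 * t) := fun i t => by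
    rw [← Real.rpow_natCast_mul (hσ_pos i).le]
    congr 1
    push_cast
    ring
  simp only [h_rpow, mul_add 2 ν μ]
  constructor
  · rintro ⟨C, hC, α₀, hα₀, h⟩
    have h_small : ∀ᶠ k in Filter.atTop, σ k ^ 2 ≤ α₀ :=
      (by simpa using hσ_lim.pow 2 : Filter.Tendsto (fun k => σ k ^ 2) Filter.atTop (nhds 0))
        |>.eventually_le_const hα₀
    obtain ⟨k₀, hk₀⟩ := Filter.eventually_atTop.1 h_small
    have h_lt : (2⁻¹ : ℝ) ^ (2 * μ) < 1 :=
      Real.rpow_lt_one (by norm_num) (by norm_num) (by linarith)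
    have h_inv : 0 < (1 - (2⁻¹ : ℝ) ^ (2 * μ))⁻¹ := inv_pos.2 (sub_pos.2 h_lt)
    exact ⟨4 * 2 ^ (2 * ν) * C * (1 - (2⁻¹ : ℝ) ^ (2 * μ))⁻¹, by positivity, k₀, fun k hk =>
      tail_le_of_tikhonov_residual_le hs_anti hs_pos hb hb_sum (by linarith) (by linarith) hC h
        (hk₀ k hk)⟩
  · rintro ⟨D, hD, k₀, h⟩
    obtain ⟨D', hD', h'⟩ :=
      exists_forall_tail_le hs_anti hs_pos hb hb_sum (by linarith : 0 ≤ 2 * μ) hD h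
    have h_lt : (2 : ℝ) ^ (2 * ν + 2 * μ - 2) < 1 :=
      Real.rpow_lt_one_of_one_lt_of_neg (by norm_num) (by linarith)
    have h_inv : 0 < (1 - (2 : ℝ) ^ (2 * ν + 2 * μ - 2))⁻¹ := inv_pos.2 (sub_pos.2 h_lt)
    exact ⟨D' + 2 ^ (2 * ν + 2 * μ) * D' * (1 - (2 : ℝ) ^ (2 * ν + 2 * μ - 2))⁻¹,
      by positivity, 1, one_pos, fun α hα _ =>
        tikhonov_residual_le_of_tail_le hs_anti hs_pos hb hb_sum (by linarith) (by linarith)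
          (by linarith) hD'.le h' hα⟩
end

section
/- Let X, Y be Hilbert spaces, A : X → Y a bounded linear operator, {v_i}_{i∈ℕ} an orthonormal family in X, {u_i}_{i∈ℕ} an orthonormal family in Y, and σ : ℕ → ℝ a nonincreasing sequence with 0 < σ_i ≤ 1, σ_i → 0, A v_i = σ_i u_i and A* u_i = σ_i v_i for all i. Let x† ∈ X lie in the closed span of {v_i} and set y = A x† and x_α = (A*A + αI)^{-1} A* y for α > 0. Let 0 < μ < 1/2. Then there exist C > 0 and α₀ > 0 such that ‖A x_α − y‖ ≤ C · α^{μ + 1/2} for all 0 < α ≤ α₀, if and only if there exist C' > 0 and k₀ with Σ_{n=k}^∞ ⟨x†, v_n⟩² ≤ C' · σ_k^{4μ} for all k ≥ k₀. -/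
open scoped RealInnerProductSpace

/-- Bounds on dyadic blocks `t / 2 < σ n ≤ t` sum up to a bound on `σ n ≤ t`. -/
lemma sum_filter_le_of_dyadic_block_le {ι : Type*} {a σ : ι → ℝ} (s : Finset ι)
    (hσ : ∀ i, 0 < σ i) {p K T : ℝ} (hp : 0 < p) (hK : 0 ≤ K)
    (h : ∀ t, 0 < t → t ≤ T → ∑ n ∈ s with t / 2 < σ n ∧ σ n ≤ t, a n ≤ K * t ^ p)
    {t : ℝ} (ht : 0 < t) (htT : t ≤ T) :
    ∑ n ∈ s with σ n ≤ t, a n ≤ K / (1 - (1 / 2 : ℝ) ^ p) * t ^ p := by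
  have hq : (1 / 2 : ℝ) ^ p < 1 := Real.rpow_lt_one (by norm_num) (by norm_num) hp
  have hq' : 0 < 1 - (1 / 2 : ℝ) ^ p := by linarith
  have key : ∀ j : ℕ, ∀ t, 0 < t → t ≤ T → (∀ n ∈ s, t < 2 ^ j * σ n) →
      ∑ n ∈ s with σ n ≤ t, a n ≤ K / (1 - (1 / 2 : ℝ) ^ p) * t ^ p := by
    intro j
    induction j with
    | zero =>
      intro t ht _ hs
      rw [Finset.filter_false_of_mem (fun n hn => by simpa using hs n hn), Finset.sum_empty]
      positivity
    | succ j ih =>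
      intro t ht htT hs
      have h1 := ih (t / 2) (by positivity) (by linarith)
        (fun n hn => by have := hs n hn; rw [pow_succ] at this; linarith)
      have h2 := h t ht htT
      have hsplit : ∑ n ∈ s with σ n ≤ t, a n =
          ∑ n ∈ s with σ n ≤ t / 2, a n + ∑ n ∈ s with t / 2 < σ n ∧ σ n ≤ t, a n := by
        simp only [Finset.sum_filter]
        rw [← Finset.sum_add_distrib]
        refine Finset.sum_congr rfl fun n _ => ?_
        split_ifs <;> grind
      have h3 : (t / 2) ^ p = (1 / 2 : ℝ) ^ p * t ^ p := by
        rw [← Real.mul_rpow (by norm_num) ht.le]; ring_nf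
      rw [h3] at h1
      rw [hsplit]
      calc _ ≤ K / (1 - (1 / 2 : ℝ) ^ p) * ((1 / 2 : ℝ) ^ p * t ^ p) + K * t ^ p :=
            add_le_add h1 h2
        _ = _ := by field_simp; ring
  obtain ⟨δ, hδ, hδs⟩ : ∃ δ > 0, ∀ n ∈ s, δ ≤ σ n := by
    rcases s.eq_empty_or_nonempty with rfl | hs
    · exact ⟨1, one_pos, by simp⟩
    · obtain ⟨m, _, hm⟩ := s.exists_min_image σ hs
      exact ⟨σ m, hσ m, hm⟩
  obtain ⟨j, hj⟩ := pow_unbounded_of_one_lt (t / δ) (one_lt_two (α := ℝ))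
  refine key j t ht htT fun n hn => ?_
  rw [div_lt_iff₀ hδ] at hj
  exact hj.trans_le (by gcongr; exact hδs n hn)

/-- Bounds on the sums over `σ n ≤ t` of order `t ^ p`, `p < 2`, give bounds of order
`t ^ (p - 2)` on the weighted sums over `t < σ n`. -/
lemma sum_filter_div_sq_le {ι : Type*} {a σ : ι → ℝ} (s : Finset ι) (ha : ∀ i, 0 ≤ a i)
    {p K M : ℝ} (hp : p < 2) (hK : 0 ≤ K) (hσ : ∀ i, σ i ≤ M)
    (h : ∀ t, 0 < t → ∑ n ∈ s with σ n ≤ t, a n ≤ K * t ^ p) {t : ℝ} (ht : 0 < t) :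
    ∑ n ∈ s with t < σ n, a n / σ n ^ 2 ≤
      K * 2 ^ p / (1 - (2 : ℝ) ^ (p - 2)) * t ^ (p - 2) := by
  have hq : (2 : ℝ) ^ (p - 2) < 1 := Real.rpow_lt_one_of_one_lt_of_neg (by norm_num) (by linarith)
  have hq' : 0 < 1 - (2 : ℝ) ^ (p - 2) := by linarith
  have key : ∀ j : ℕ, ∀ t, 0 < t → M ≤ 2 ^ j * t →
      ∑ n ∈ s with t < σ n, a n / σ n ^ 2 ≤
        K * 2 ^ p / (1 - (2 : ℝ) ^ (p - 2)) * t ^ (p - 2) := by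
    intro j
    induction j with
    | zero =>
      intro t ht hs
      rw [Finset.filter_false_of_mem (fun n _ => by simpa using (hσ n).trans hs), Finset.sum_empty]
      positivity
    | succ j ih =>
      intro t ht hs
      have h1 := ih (2 * t) (by positivity) (by rw [pow_succ] at hs; linarith)
      have h2 := h (2 * t) (by positivity)
      have hsplit : ∑ n ∈ s with t < σ n, a n / σ n ^ 2 ≤
          ∑ n ∈ s with 2 * t < σ n, a n / σ n ^ 2 + (∑ n ∈ s with σ n ≤ 2 * t, a n) / t ^ 2 := by
        simp only [Finset.sum_filter, Finset.sum_div]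
        rw [← Finset.sum_add_distrib]
        refine Finset.sum_le_sum fun n _ => ?_
        have han := ha n
        rcases le_or_gt (σ n) t with h1 | h1
        · rw [if_neg h1.not_gt]
          split_ifs <;> positivity
        · rcases le_or_gt (σ n) (2 * t) with h2 | h2
          · rw [if_pos h1, if_neg h2.not_gt, if_pos h2, zero_add]
            gcongr
          · rw [if_pos h1, if_pos h2, if_neg h2.not_ge]
            simp
      have h3 : (2 * t) ^ (p - 2) = 2 ^ (p - 2) * t ^ (p - 2) :=
        Real.mul_rpow (by norm_num) ht.le
      have h4 : (2 * t) ^ p / t ^ 2 = 2 ^ p * t ^ (p - 2) := by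
        rw [Real.mul_rpow (by norm_num) ht.le, Real.rpow_sub ht, Real.rpow_two, mul_div_assoc]
      rw [h3] at h1
      calc _ ≤ _ := hsplit
        _ ≤ K * 2 ^ p / (1 - (2 : ℝ) ^ (p - 2)) * (2 ^ (p - 2) * t ^ (p - 2)) +
            K * (2 * t) ^ p / t ^ 2 := by gcongr
        _ = K * 2 ^ p / (1 - (2 : ℝ) ^ (p - 2)) * (2 ^ (p - 2) * t ^ (p - 2)) +
            K * (2 ^ p * t ^ (p - 2)) := by rw [mul_div_assoc K ((2 * t) ^ p), h4]
        _ = _ := by field_simp; ring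
  obtain ⟨j, hj⟩ := pow_unbounded_of_one_lt (M / t) (one_lt_two (α := ℝ))
  exact key j t ht ((div_lt_iff₀ ht).1 hj).le

/-- Bounds on the tails `∑ n ≥ k, a n` in terms of `σ k` give bounds on all finite sums over
`σ n ≤ t`. -/
lemma exists_sum_filter_le_of_tail_le {a σ : ℕ → ℝ} (ha : ∀ i, 0 ≤ a i) (hsum : Summable a)
    (hσ_anti : Antitone σ) (hσ_pos : ∀ i, 0 < σ i)
    (hσ_lim : Filter.Tendsto σ Filter.atTop (nhds 0)) {p C : ℝ} (hp : 0 < p) (hC : 0 < C) {k₀ : ℕ}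
    (h : ∀ k, k₀ ≤ k → ∑' n, a (k + n) ≤ C * σ k ^ p) :
    ∃ K > 0, ∀ (s : Finset ℕ) (t : ℝ), 0 < t → ∑ n ∈ s with σ n ≤ t, a n ≤ K * t ^ p := by
  have hS : 0 ≤ ∑' n, a n := tsum_nonneg ha
  have hk₀ := hσ_pos k₀
  refine ⟨C + (∑' n, a n) / σ k₀ ^ p, by positivity, fun s t ht => ?_⟩
  rw [add_mul]
  rcases le_or_gt (σ k₀) t with h1 | h1
  · calc ∑ n ∈ s with σ n ≤ t, a n ≤ ∑' n, a n := hsum.sum_le_tsum _ fun i _ => ha i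
      _ = (∑' n, a n) / σ k₀ ^ p * σ k₀ ^ p := by field_simp
      _ ≤ (∑' n, a n) / σ k₀ ^ p * t ^ p := by gcongr
      _ ≤ _ := le_add_of_nonneg_left (by positivity)
  · have hex : ∃ k, σ k ≤ t := ((hσ_lim.eventually (gt_mem_nhds ht)).exists).imp fun _ h => h.le
    classical
    set k := Nat.find hex with hk
    have hkt : σ k ≤ t := Nat.find_spec hex
    have hk₀k : k₀ ≤ k := by
      by_contra! hlt
      exact absurd (hσ_anti hlt.le) (by linarith)
    have hdisj : Disjoint (s.filter fun n => σ n ≤ t) (Finset.range k) := by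
      rw [Finset.disjoint_left]
      intro n hn hn'
      exact Nat.find_min hex (Finset.mem_range.1 hn') (Finset.mem_filter.1 hn).2
    have h2 := hsum.sum_le_tsum ((s.filter fun n => σ n ≤ t) ∪ Finset.range k) fun i _ => ha i
    rw [Finset.sum_union hdisj, ← hsum.sum_add_tsum_nat_add k] at h2
    have h3 := h k hk₀k
    simp only [add_comm k] at h3
    calc ∑ n ∈ s with σ n ≤ t, a n ≤ C * σ k ^ p := by linarith
      _ ≤ C * t ^ p := by gcongr; exact (hσ_pos k).le
      _ ≤ _ := le_add_of_nonneg_right (by positivity)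

section Tikhonov

open ContinuousLinearMap

variable {X Y : Type*} [NormedAddCommGroup X] [InnerProductSpace ℝ X] [CompleteSpace X]
  [NormedAddCommGroup Y] [InnerProductSpace ℝ Y] [CompleteSpace Y]

lemma exists_tikhonov_solution (A : X →L[ℝ] Y) {α : ℝ} (hα : 0 < α) (b : X) :
    ∃ x : X, adjoint A (A x) + α • x = b := by
  have hu : IsUnit (adjoint A ∘L A + α • ContinuousLinearMap.id ℝ X) := by
    refine isUnit_of_forall_le_norm_inner_map _ (c := ⟨α, hα.le⟩) hα fun x => ?_
    have : ⟪(adjoint A ∘L A + α • ContinuousLinearMap.id ℝ X) x, x⟫ = ‖A x‖ ^ 2 + α * ‖x‖ ^ 2 := by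
      simp [inner_add_left, adjoint_inner_left, real_inner_smul_left]
    rw [this]
    refine le_trans ?_ (le_abs_self _)
    change ‖x‖ ^ 2 * α ≤ _
    nlinarith [sq_nonneg ‖A x‖]
  obtain ⟨e, he⟩ := hu
  refine ⟨(↑e⁻¹ : X →L[ℝ] X) b, ?_⟩
  have h := congrArg (fun f : X →L[ℝ] X => f b) e.mul_inv
  simp only [he] at h
  simpa using h

/-- Coefficients of the Tikhonov residual along the left singular vectors. -/
lemma inner_tikhonov_residual {A : X →L[ℝ] Y} {α σ : ℝ} (hα : 0 < α) {v : X} {u : Y}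
    (hAv : A v = σ • u) (hAu : adjoint A u = σ • v) {x x₀ : X}
    (hx : adjoint A (A x) + α • x = adjoint A (A x₀)) :
    ⟪u, A x - A x₀⟫ = -(α * σ / (α + σ ^ 2) * ⟪x₀, v⟫) := by
  have h1 : ∀ w : X, ⟪u, A w⟫ = σ * ⟪v, w⟫ := fun w => by
    rw [← adjoint_inner_left, hAu, real_inner_smul_left]
  have h2 : ∀ w : X, ⟪v, adjoint A (A w)⟫ = σ ^ 2 * ⟪v, w⟫ := fun w => by
    rw [adjoint_inner_right, hAv, real_inner_smul_left, h1]; ring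
  have h3 := congrArg (fun w => ⟪v, w⟫) hx
  simp only [inner_add_right, real_inner_smul_right, h2] at h3
  have h4 : ⟪v, x⟫ = σ ^ 2 * ⟪v, x₀⟫ / (α + σ ^ 2) := by
    rw [eq_div_iff (by positivity)]; linarith
  rw [inner_sub_right, h1, h1, h4, real_inner_comm x₀ v]
  field_simp
  ring

/-- Parseval's identity for the Tikhonov residual along the left singular vectors. -/
lemma hasSum_sq_inner_tikhonov_residual {A : X →L[ℝ] Y} {v : ℕ → X} {u : ℕ → Y}
    (hu : Orthonormal ℝ u) {σ : ℕ → ℝ} (hAv : ∀ i, A (v i) = σ i • u i)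
    (hAu : ∀ i, adjoint A (u i) = σ i • v i) {x x₀ : X}
    (hx₀ : x₀ ∈ (Submodule.span ℝ (Set.range v)).topologicalClosure) {α : ℝ} (hα : 0 < α)
    (hx : adjoint A (A x) + α • x = adjoint A (A x₀)) :
    HasSum (fun n => ⟪u n, A x - A x₀⟫ ^ 2) (‖A x - A x₀‖ ^ 2) := by
  set r := A x - A x₀ with hr
  have hsumm : Summable fun n => ⟪u n, r⟫ • u n := by
    have h1 := hu.orthogonalFamily.summable_iff_norm_sq_summable (fun n => ⟪u n, r⟫)
    simp only [LinearIsometry.toSpanSingleton_apply] at h1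
    exact h1.2 (hu.inner_products_summable r)
  obtain ⟨r', hr'⟩ := hsumm
  set z := r - r' with hz
  have huz : ∀ n, ⟪z, u n⟫ = 0 := fun n => by
    have h1 : HasSum (fun m => ⟪u n, ⟪u m, r⟫ • u m⟫) ⟪u n, r'⟫ := hr'.mapL (innerSL ℝ (u n))
    have h2 : HasSum (fun m => ⟪u n, ⟪u m, r⟫ • u m⟫) ⟪u n, ⟪u n, r⟫ • u n⟫ := by
      refine hasSum_single n fun m hm => ?_
      rw [real_inner_smul_right, hu.2 hm.symm, mul_zero]
    have h3 := h1.unique h2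
    rw [real_inner_smul_right, real_inner_self_eq_norm_sq, hu.1 n] at h3
    rw [real_inner_comm, hz, inner_sub_right, h3]
    ring
  have hzero : ∀ L : Y →L[ℝ] ℝ, (∀ n, L (u n) = 0) → L r' = 0 := fun L hL => by
    have h1 := hr'.mapL L
    simp only [map_smul, hL, smul_zero] at h1
    exact h1.unique hasSum_zero
  have h1 : ⟪z, r'⟫ = 0 := hzero (innerSL ℝ z) huz
  have h2 : ⟪z, A (adjoint A r')⟫ = 0 :=
    hzero (innerSL ℝ z ∘L A ∘L adjoint A) fun n => by
      simp [hAu, hAv, huz]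
  have h3 : ⟪z, A x₀⟫ = 0 := by
    have hle : (Submodule.span ℝ (Set.range v)).topologicalClosure ≤
        LinearMap.ker (innerSL ℝ z ∘L A).toLinearMap := by
      refine Submodule.topologicalClosure_minimal _ ?_ (innerSL ℝ z ∘L A).isClosed_ker
      rw [Submodule.span_le]
      rintro _ ⟨n, rfl⟩
      simp [hAv, real_inner_smul_right, huz]
    exact hle hx₀
  have h4 : A (adjoint A r) + α • r = -(α • A x₀) := by
    have h5 : adjoint A r = -(α • x) := by
      rw [hr, map_sub, ← hx]; abel
    rw [h5, map_neg, map_smul, hr, smul_sub]; abel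
  have h5 := congrArg (fun w => ⟪z, w⟫) h4
  have h6 : r = z + r' := by rw [hz]; abel
  rw [h6] at h5
  simp only [map_add, inner_add_right, smul_add, real_inner_smul_right, h1, h2, inner_neg_right,
    h3, mul_zero, add_zero, neg_zero, ← adjoint_inner_left A, real_inner_self_eq_norm_sq] at h5
  have h7 : ‖z‖ ^ 2 = 0 := by
    have := sq_nonneg ‖adjoint A z‖
    nlinarith [sq_nonneg ‖z‖]
  have h8 : r' = r := by
    have : z = 0 := by simpa using h7
    rw [h6, this, zero_add]
  rw [h8] at hr'
  have h9 : HasSum (fun m => ⟪r, ⟪u m, r⟫ • u m⟫) ⟪r, r⟫ := hr'.mapL (innerSL ℝ r)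
  rw [real_inner_self_eq_norm_sq] at h9
  convert h9 using 2 with n
  rw [real_inner_smul_right, real_inner_comm r, sq]

end Tikhonov

/-- The `ν = 1/2` case of the converse theorem: the noise-free Tikhonov residual satisfies
`‖A x_α - y‖ = O(α^(μ+1/2))` if and only if the tail-sum Hölder source condition with
parameter `0 < μ < 1/2` holds.  Here `x_α` is characterized by the normal equation
`A* A x_α + α x_α = A* y`. -/
theorem residual_rate_iff_source_condition
    {X Y : Type*} [NormedAddCommGroup X] [InnerProductSpace ℝ X] [CompleteSpace X]
    [NormedAddCommGroup Y] [InnerProductSpace ℝ Y] [CompleteSpace Y]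
    (A : X →L[ℝ] Y) (v : ℕ → X) (u : ℕ → Y)
    (hv : Orthonormal ℝ v) (hu : Orthonormal ℝ u)
    (σ : ℕ → ℝ) (hσ_anti : Antitone σ) (hσ_pos : ∀ i, 0 < σ i) (hσ_le : ∀ i, σ i ≤ 1)
    (hσ_lim : Filter.Tendsto σ Filter.atTop (nhds 0))
    (hAv : ∀ i, A (v i) = σ i • u i)
    (hAu : ∀ i, (ContinuousLinearMap.adjoint A) (u i) = σ i • v i)
    (xdag : X) (hxdag : xdag ∈ (Submodule.span ℝ (Set.range v)).topologicalClosure)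
    (y : Y) (hy : y = A xdag)
    (μ : ℝ) (hμ : 0 < μ) (hμ' : μ < 1 / 2) :
    (∃ C > (0 : ℝ), ∃ α₀ > (0 : ℝ), ∀ α : ℝ, 0 < α → α ≤ α₀ →
        ∀ xα : X, (ContinuousLinearMap.adjoint A) (A xα) + α • xα
            = (ContinuousLinearMap.adjoint A) y →
          ‖A xα - y‖ ≤ C * α ^ (μ + 1 / 2))
      ↔ (∃ C' > (0 : ℝ), ∃ k₀ : ℕ, ∀ k : ℕ, k₀ ≤ k →
          ∑' n : ℕ, ⟪xdag, v (k + n)⟫ ^ 2 ≤ C' * σ k ^ (4 * μ)) := by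
  subst hy
  have hparseval := fun (α : ℝ) (hα : 0 < α) (x : X) hx =>
    hasSum_sq_inner_tikhonov_residual hu hAv hAu (x := x) hxdag hα hx
  have hcoeff : ∀ (α : ℝ), 0 < α → ∀ x : X, ContinuousLinearMap.adjoint A (A x) + α • x =
      ContinuousLinearMap.adjoint A (A xdag) → ∀ n, ⟪u n, A x - A xdag⟫ ^ 2 =
        (α * σ n / (α + σ n ^ 2)) ^ 2 * ⟪xdag, v n⟫ ^ 2 := fun α hα x hx n => by
    rw [inner_tikhonov_residual hα (hAv n) (hAu n) hx]; ring
  have hsum : Summable fun n => ⟪xdag, v n⟫ ^ 2 := by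
    have h := hv.inner_products_summable xdag
    simpa only [Real.norm_eq_abs, sq_abs, real_inner_comm] using h
  have hp : 0 < 4 * μ := by linarith
  constructor
  · rintro ⟨C, hC, α₀, hα₀, h⟩
    have hblock : ∀ (s : Finset ℕ) t, 0 < t → t ≤ √α₀ →
        ∑ n ∈ s with t / 2 < σ n ∧ σ n ≤ t, ⟪xdag, v n⟫ ^ 2 ≤ 16 * C ^ 2 * t ^ (4 * μ) := by
      intro s t ht htα
      have hα : 0 < t ^ 2 := by positivity
      have htα' : t ^ 2 ≤ α₀ := by
        rw [← Real.sq_sqrt hα₀.le]; gcongr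
      obtain ⟨x, hx⟩ := exists_tikhonov_solution A hα (ContinuousLinearMap.adjoint A (A xdag))
      have h1 := h (t ^ 2) hα htα' x hx
      have h2 := sum_le_hasSum (s.filter fun n => t / 2 < σ n ∧ σ n ≤ t)
        (fun n _ => sq_nonneg _) (hparseval _ hα x hx)
      have h3 : ∑ n ∈ s with t / 2 < σ n ∧ σ n ≤ t, ⟪xdag, v n⟫ ^ 2 ≤
          16 / t ^ 2 * ∑ n ∈ s with t / 2 < σ n ∧ σ n ≤ t, ⟪u n, A x - A xdag⟫ ^ 2 := by
        rw [Finset.mul_sum]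
        refine Finset.sum_le_sum fun n hn => ?_
        obtain ⟨-, hn1, hn2⟩ := Finset.mem_filter.1 hn
        have hσn := hσ_pos n
        have hw : t / 4 ≤ t ^ 2 * σ n / (t ^ 2 + σ n ^ 2) := by
          rw [le_div_iff₀ (by positivity)]
          have : σ n ^ 2 ≤ t ^ 2 := by gcongr
          nlinarith
        rw [hcoeff _ hα x hx n, ← mul_assoc]
        refine le_mul_of_one_le_left (sq_nonneg _) ?_
        calc (1 : ℝ) = 16 / t ^ 2 * (t / 4) ^ 2 := by field_simp; norm_num
          _ ≤ _ := by gcongr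
      have h4 : ((t ^ 2) ^ (μ + 1 / 2)) ^ 2 = t ^ (4 * μ) * t ^ 2 := by
        rw [← Real.rpow_natCast t 2, ← Real.rpow_mul ht.le, ← Real.rpow_mul_natCast ht.le,
          ← Real.rpow_add ht]
        congr 1; push_cast; ring
      calc _ ≤ _ := h3
        _ ≤ 16 / t ^ 2 * (C * (t ^ 2) ^ (μ + 1 / 2)) ^ 2 := by
          gcongr
          exact h2.trans (by gcongr)
        _ = _ := by rw [mul_pow, h4]; field_simp
    have hq : (1 / 2 : ℝ) ^ (4 * μ) < 1 := Real.rpow_lt_one (by norm_num) (by norm_num) hp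
    have hq' : 0 < 1 - (1 / 2 : ℝ) ^ (4 * μ) := by linarith
    obtain ⟨k₀, hk₀⟩ := (hσ_lim.eventually (gt_mem_nhds (Real.sqrt_pos.2 hα₀))).exists
    refine ⟨16 * C ^ 2 / (1 - (1 / 2 : ℝ) ^ (4 * μ)), by positivity, k₀, fun k hk => ?_⟩
    refine Real.tsum_le_of_sum_range_le (fun n => sq_nonneg _) fun m => ?_
    have h1 := sum_filter_le_of_dyadic_block_le (Finset.Ico k (k + m)) hσ_pos hp (by positivity)
      (hblock _) (hσ_pos k) ((hσ_anti hk).trans hk₀.le)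
    rw [Finset.filter_true_of_mem fun n hn => hσ_anti (Finset.mem_Ico.1 hn).1,
      Finset.sum_Ico_eq_sum_range] at h1
    simpa using h1
  · rintro ⟨C, hC, k₀, h⟩
    obtain ⟨K, hK, hF⟩ := exists_sum_filter_le_of_tail_le (fun n => sq_nonneg ⟪xdag, v n⟫) hsum
      hσ_anti hσ_pos hσ_lim hp hC h
    have hq : (2 : ℝ) ^ (4 * μ - 2) < 1 :=
      Real.rpow_lt_one_of_one_lt_of_neg (by norm_num) (by linarith)
    have hq' : 0 < 1 - (2 : ℝ) ^ (4 * μ - 2) := by linarith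
    set M := K * 2 ^ (4 * μ) / (1 - (2 : ℝ) ^ (4 * μ - 2)) with hM
    have hMpos : 0 < M := by positivity
    refine ⟨√(K + M), by positivity, 1, one_pos, fun α hα _ x hx => ?_⟩
    obtain ⟨t, ht, rfl⟩ : ∃ t > 0, t ^ 2 = α := ⟨√α, Real.sqrt_pos.2 hα, Real.sq_sqrt hα.le⟩
    have h4 : ((t ^ 2) ^ (μ + 1 / 2)) ^ 2 = t ^ (4 * μ) * t ^ 2 := by
      rw [← Real.rpow_natCast t 2, ← Real.rpow_mul ht.le, ← Real.rpow_mul_natCast ht.le,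
        ← Real.rpow_add ht]
      congr 1; push_cast; ring
    refine (sq_le_sq₀ (norm_nonneg _) (by positivity)).1 ?_
    rw [mul_pow, Real.sq_sqrt (by positivity), h4]
    refine hasSum_le_of_sum_le (hparseval _ hα x hx) fun s => ?_
    have h1 := hF s t ht
    have h2 := sum_filter_div_sq_le s (fun n => sq_nonneg ⟪xdag, v n⟫) (by linarith) hK.le hσ_le
      (hF s) ht
    rw [← hM] at h2
    have h3 : ∑ n ∈ s, ⟪u n, A x - A xdag⟫ ^ 2 ≤
        t ^ 2 * ∑ n ∈ s with σ n ≤ t, ⟪xdag, v n⟫ ^ 2 +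
          t ^ 4 * ∑ n ∈ s with t < σ n, ⟪xdag, v n⟫ ^ 2 / σ n ^ 2 := by
      rw [Finset.mul_sum, Finset.mul_sum, Finset.sum_filter, Finset.sum_filter,
        ← Finset.sum_add_distrib]
      refine Finset.sum_le_sum fun n _ => ?_
      rw [hcoeff _ hα x hx n]
      have hσn := hσ_pos n
      rcases le_or_gt (σ n) t with hn | hn
      · rw [if_pos hn, if_neg hn.not_gt, add_zero]
        have : t ^ 2 * σ n / (t ^ 2 + σ n ^ 2) ≤ t := by
          rw [div_le_iff₀ (by positivity)]
          nlinarith [mul_le_mul_of_nonneg_left hn hα.le, mul_pos ht (pow_pos hσn 2)]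
        gcongr
      · rw [if_neg hn.not_ge, if_pos hn, zero_add]
        have : t ^ 2 * σ n / (t ^ 2 + σ n ^ 2) ≤ t ^ 2 / σ n := by
          rw [div_le_div_iff₀ (by positivity) hσn]
          nlinarith [pow_pos ht 4]
        calc _ ≤ (t ^ 2 / σ n) ^ 2 * ⟪xdag, v n⟫ ^ 2 := by gcongr
          _ = _ := by ring
    calc _ ≤ _ := h3
      _ ≤ t ^ 2 * (K * t ^ (4 * μ)) + t ^ 4 * (M * t ^ (4 * μ - 2)) := by gcongr
      _ = _ := by
        rw [Real.rpow_sub ht, Real.rpow_two]; field_simp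
end

section
/- Let X, Y be Hilbert spaces, A : X → Y a bounded linear operator, and let x† ∈ X belong to the closure of the range of A*. For α > 0 set x_α = (A*A + αI)^{-1} A* (A x†). Then ‖A*A (x_α − x†)‖ / α → ‖x†‖ as α → 0⁺; in particular, if x† ≠ 0 then ‖A*A(x_α − x†)‖ is asymptotically of order exactly α. -/
open Filter Topology ContinuousLinearMap

section Tikhonov

variable {X Y : Type*} [NormedAddCommGroup X] [InnerProductSpace ℝ X] [CompleteSpace X]
  [NormedAddCommGroup Y] [InnerProductSpace ℝ Y] [CompleteSpace Y]

/-- Error bound for noise-free Tikhonov regularization: the squared error is controlled by the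
distance of the exact solution `z` to an element `A* y` of the range of the adjoint. -/
theorem tikhonov_error_sq_le (A : X →L[ℝ] Y) {x z : X} {α : ℝ} (hα : 0 < α)
    (h : adjoint A (A x) + α • x = adjoint A (A z)) (y : Y) :
    ‖x - z‖ ^ 2 ≤ ‖z - adjoint A y‖ ^ 2 + α * ‖y‖ ^ 2 / 2 := by
  set e := x - z with he
  have normal_eq : adjoint A (A e) + α • e = -(α • z) := by
    rw [he, map_sub, map_sub, ← h]
    module
  have energy : ‖A e‖ ^ 2 + α * ‖e‖ ^ 2 = -(α * inner ℝ z e) := by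
    have := congrArg (fun v => inner ℝ v e) normal_eq
    simpa [inner_add_left, inner_neg_left, real_inner_smul_left, adjoint_inner_left] using this
  have split : inner ℝ z e = inner ℝ (z - adjoint A y) e + inner ℝ y (A e) := by
    rw [inner_sub_left, adjoint_inner_left]
    ring
  have h₁ := neg_le_of_abs_le (abs_real_inner_le_norm (z - adjoint A y) e)
  have h₂ := neg_le_of_abs_le (abs_real_inner_le_norm y (A e))
  have h₃ : α * -inner ℝ z e ≤
      α * (‖z - adjoint A y‖ * ‖e‖ + ‖y‖ * ‖A e‖) :=
    mul_le_mul_of_nonneg_left (by linarith) hα.le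
  have h₄ : α * ‖e‖ ^ 2 ≤ α * (‖z - adjoint A y‖ * ‖e‖ + α * ‖y‖ ^ 2 / 4) := by
    nlinarith [sq_nonneg (‖A e‖ - α * ‖y‖ / 2)]
  have h₅ := le_of_mul_le_mul_left h₄ hα
  nlinarith [sq_nonneg (‖z - adjoint A y‖ - ‖e‖)]

/-- Noise-free Tikhonov approximations converge to any exact solution in the closure of the range
of the adjoint. -/
theorem tendsto_tikhonov (A : X →L[ℝ] Y) {z : X} (hz : z ∈ closure (Set.range (adjoint A)))
    {x : ℝ → X} (hx : ∀ α : ℝ, 0 < α → adjoint A (A (x α)) + α • x α = adjoint A (A z)) :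
    Tendsto x (𝓝[>] 0) (𝓝 z) := by
  rw [Metric.tendsto_nhds]
  intro ε hε
  obtain ⟨_, ⟨y, rfl⟩, hy⟩ := Metric.mem_closure_iff.mp hz (ε / 2) (half_pos hε)
  rw [dist_eq_norm] at hy
  have small : ∀ᶠ α : ℝ in 𝓝[>] 0, α * ‖y‖ ^ 2 / 2 < ε ^ 2 / 2 := by
    have : Tendsto (fun α : ℝ => α * ‖y‖ ^ 2 / 2) (𝓝 0) (𝓝 (0 * ‖y‖ ^ 2 / 2)) :=
      Continuous.tendsto (by fun_prop) 0
    exact (this.mono_left nhdsWithin_le_nhds).eventually_lt_const (by simpa using by positivity)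
  filter_upwards [small, self_mem_nhdsWithin] with α hα hpos
  rw [dist_eq_norm]
  refine lt_of_pow_lt_pow_left₀ 2 hε.le ?_
  nlinarith [tikhonov_error_sq_le A hpos (hx α hpos) y, norm_nonneg (z - adjoint A y)]

end Tikhonov

/-- Asymptotics of the Tikhonov gradient for exact data: if `x†` lies in the closure of the
range of `A*`, then `‖A*A (x_α - x†)‖ / α → ‖x†‖` as `α → 0⁺`; in particular, for `x† ≠ 0`
the gradient norm is asymptotically of order exactly `α`. -/
theorem tikhonov_gradient_asymptotics
    {X Y : Type*} [NormedAddCommGroup X] [InnerProductSpace ℝ X] [CompleteSpace X]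
    [NormedAddCommGroup Y] [InnerProductSpace ℝ Y] [CompleteSpace Y]
    (A : X →L[ℝ] Y) (xdag : X)
    (hxdag : xdag ∈ closure (Set.range (⇑(ContinuousLinearMap.adjoint A))))
    (xα : ℝ → X)
    (hxα : ∀ α : ℝ, 0 < α → (ContinuousLinearMap.adjoint A) (A (xα α)) + α • xα α
      = (ContinuousLinearMap.adjoint A) (A xdag)) :
    Filter.Tendsto (fun α : ℝ => ‖(ContinuousLinearMap.adjoint A) (A (xα α - xdag))‖ / α)
      (nhdsWithin 0 (Set.Ioi 0)) (nhds ‖xdag‖) := by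
  refine (tendsto_tikhonov A hxdag hxα).norm.congr' ?_
  filter_upwards [self_mem_nhdsWithin] with α hα
  have hpos : 0 < α := hα
  have gradient_eq : adjoint A (A (xα α - xdag)) = -(α • xα α) := by
    rw [map_sub, map_sub, ← hxα α hpos]
    abel
  rw [gradient_eq, norm_neg, norm_smul, Real.norm_of_nonneg hpos.le,
    mul_div_cancel_left₀ _ hpos.ne']
end

section
/- Let X, Y be Hilbert spaces, A : X → Y a bounded linear operator with a singular system: orthonormal families {v_i} ⊂ X, {u_i} ⊂ Y and a nonincreasing sequence σ with 0 < σ_i ≤ 1, σ_i → 0, A v_i = σ_i u_i, A* u_i = σ_i v_i. Let x† ∈ X lie in the closed span of {v_i} and satisfy the tail source condition with parameter μ ∈ (0, 1/2): Σ_{n=k}^∞ ⟨x†, v_n⟩² ≤ C' σ_k^{4μ} for all k ≥ k₀. Set y = A x†, let y^δ ∈ Y with ‖y − y^δ‖ ≤ δ, and x_α^δ = (A*A + αI)^{-1} A* y^δ. Then there exists a constant C > 0 (independent of δ and α) such that the heuristic-discrepancy functional satisfies ‖A x_α^δ − y^δ‖²/α ≤ C (α^{2μ} + δ²/α) for all sufficiently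 small α > 0. -/
open scoped RealInnerProductSpace

/-- A gradient inequality for the concave function `x ↦ x ^ θ`, taken at the right endpoint. -/
theorem mul_rpow_sub_one_mul_sub_le {a b θ : ℝ} (ha : 0 < a) (hab : a ≤ b) (hθ : 0 ≤ θ)
    (hθ' : θ ≤ 1) : θ * (b ^ (θ - 1) * (b - a)) ≤ b ^ θ - a ^ θ := by
  have hb : 0 < b := ha.trans_le hab
  have hbern : (a / b) ^ θ ≤ 1 + θ * (a / b - 1) := by
    have h : -1 ≤ a / b - 1 := by linarith [div_pos ha hb]
    have := rpow_one_add_le_one_add_mul_self h hθ hθ'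
    rwa [add_sub_cancel] at this
  rw [Real.div_rpow ha.le hb.le, div_le_iff₀ (Real.rpow_pos_of_pos hb θ)] at hbern
  rw [Real.rpow_sub_one hb.ne']
  have : θ * (b ^ θ / b * (b - a)) = -(θ * (a / b - 1) * b ^ θ) := by
    field_simp
    ring
  linarith

/-- Summation by parts: if `T` decays at least like `s ^ (θ - 1)`, then the increments of `T`
weighted by `s` grow at most like `s ^ θ`. -/
theorem sum_sub_mul_add_le_rpow {s T : ℕ → ℝ} {C θ : ℝ} (hs : Monotone s) (hs0 : ∀ n, 0 < s n)
    (hθ : 0 < θ) (hθ' : θ ≤ 1) (hC : 0 ≤ C) (hT : ∀ n, T n ≤ C * s n ^ (θ - 1)) (k : ℕ) :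
    ∑ n ∈ Finset.range (k + 1), (T n - T (n + 1)) * s n + T (k + 1) * s k
      ≤ C / θ * s k ^ θ := by
  induction k with
  | zero =>
    have h : T 0 * s 0 ≤ C * s 0 ^ θ := by
      refine (mul_le_mul_of_nonneg_right (hT 0) (hs0 0).le).trans_eq ?_
      rw [mul_assoc, Real.rpow_sub_one (hs0 0).ne', div_mul_cancel₀ _ (hs0 0).ne']
    have h' : C * s 0 ^ θ ≤ C / θ * s 0 ^ θ :=
      mul_le_mul_of_nonneg_right (le_div_self hC hθ hθ') (Real.rpow_pos_of_pos (hs0 0) θ).le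
    simp only [zero_add, Finset.sum_range_one]
    linarith
  | succ k ih =>
    rw [Finset.sum_range_succ]
    have hk : s k ≤ s (k + 1) := hs k.le_succ
    have h₁ : T (k + 1) * (s (k + 1) - s k) ≤
        C * s (k + 1) ^ (θ - 1) * (s (k + 1) - s k) :=
      mul_le_mul_of_nonneg_right (hT _) (sub_nonneg.2 hk)
    have h₂ := mul_le_mul_of_nonneg_left
      (mul_rpow_sub_one_mul_sub_le (hs0 k) hk hθ.le hθ') (div_nonneg hC hθ.le)
    have h₃ : C / θ * (θ * (s (k + 1) ^ (θ - 1) * (s (k + 1) - s k))) =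
        C * s (k + 1) ^ (θ - 1) * (s (k + 1) - s k) := by
      field_simp
    linarith

section InnerProductSpace

variable {X Y : Type*} [NormedAddCommGroup X] [InnerProductSpace ℝ X]
  [NormedAddCommGroup Y] [InnerProductSpace ℝ Y]

theorem Orthonormal.norm_sum_smul_sq {ι : Type*} {v : ι → X} (hv : Orthonormal ℝ v)
    (a : ι → ℝ) (s : Finset ι) : ‖∑ i ∈ s, a i • v i‖ ^ 2 = ∑ i ∈ s, a i ^ 2 := by
  rw [← real_inner_self_eq_norm_sq, hv.inner_sum]
  simp [sq]

theorem Orthonormal.summable_inner_sq {ι : Type*} {v : ι → X} (hv : Orthonormal ℝ v) (x : X) :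
    Summable fun i => ⟪x, v i⟫ ^ 2 := by
  simpa [real_inner_comm] using hv.inner_products_summable x

/-- An element of the closed span of an orthonormal family is the sum of its Fourier series. -/
theorem Orthonormal.hasSum_inner_smul [CompleteSpace X] {ι : Type*} {v : ι → X}
    (hv : Orthonormal ℝ v) {x : X}
    (hx : x ∈ (Submodule.span ℝ (Set.range v)).topologicalClosure) :
    HasSum (fun i => ⟪x, v i⟫ • v i) x := by
  have hsum : Summable fun i => ⟪x, v i⟫ • v i := by
    have h := (hv.orthogonalFamily.summable_iff_norm_sq_summable fun i => ⟪x, v i⟫).2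
      (by simpa using hv.summable_inner_sq x)
    simpa using h
  obtain ⟨z, hz⟩ := hsum
  have hzmem : z ∈ (Submodule.span ℝ (Set.range v)).topologicalClosure :=
    (Submodule.isClosed_topologicalClosure _).mem_of_tendsto hz <| Filter.Eventually.of_forall
      fun s => Submodule.le_topologicalClosure _ <| Submodule.sum_mem _ fun i _ =>
        Submodule.smul_mem _ _ (Submodule.subset_span ⟨i, rfl⟩)
  have horth : ∀ i, ⟪v i, x - z⟫ = 0 := by
    intro i
    have h := hz.mapL (innerSL ℝ (v i))
    have h' : HasSum (fun j => innerSL ℝ (v i) (⟪x, v j⟫ • v j)) ⟪x, v i⟫ := by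
      convert hasSum_single i ?_ using 1
      · simp [hv.1 i]
      · intro j hj
        simp [hv.2 hj.symm]
    have := h.unique h'
    rw [inner_sub_right, real_inner_comm x (v i)]
    simp only [innerSL_apply_apply] at this
    rw [this, real_inner_comm, sub_self]
  have hperp : x - z ∈ (Submodule.span ℝ (Set.range v))ᗮ := by
    rw [Submodule.mem_orthogonal]
    intro w hw
    induction hw using Submodule.span_induction with
    | mem w hw => obtain ⟨i, rfl⟩ := hw; exact horth i
    | zero => simp
    | add a b _ _ ha hb => rw [inner_add_left, ha, hb, add_zero]
    | smul r a _ ha => rw [inner_smul_left, ha, mul_zero]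
  rw [← Submodule.orthogonal_closure] at hperp
  have h0 : ⟪x - z, x - z⟫ = 0 :=
    Submodule.inner_right_of_mem_orthogonal (Submodule.sub_mem _ hx hzmem) hperp
  rw [inner_self_eq_zero, sub_eq_zero] at h0
  rwa [← h0] at hz

/-- The residual of the Tikhonov-regularized solution does not exceed the data. -/
theorem ContinuousLinearMap.norm_apply_sub_le_of_tikhonov [CompleteSpace X] [CompleteSpace Y]
    (A : X →L[ℝ] Y) {α : ℝ} (hα : 0 ≤ α) {d : X} {f : Y}
    (h : ContinuousLinearMap.adjoint A (A d) + α • d = ContinuousLinearMap.adjoint A f) :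
    ‖A d - f‖ ≤ ‖f‖ := by
  have h₁ : ‖A d‖ ^ 2 + α * ‖d‖ ^ 2 = ⟪A d, f⟫ := by
    have := congrArg (fun w => ⟪d, w⟫) h
    simpa only [inner_add_right, inner_smul_right, ContinuousLinearMap.adjoint_inner_right,
      real_inner_self_eq_norm_sq] using this
  have h₂ := norm_sub_sq_real (A d) f
  have h₃ : 0 ≤ α * ‖d‖ ^ 2 := by positivity
  exact (sq_le_sq₀ (norm_nonneg _) (norm_nonneg _)).1 (by nlinarith [sq_nonneg ‖A d‖])

/-- Tikhonov residual at noise level `‖y - yδ‖`, split at the index `k` of a singular system. -/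
theorem norm_tikhonov_residual_le [CompleteSpace X] [CompleteSpace Y]
    (A : X →L[ℝ] Y) {v : ℕ → X} {u : ℕ → Y} {σ : ℕ → ℝ} (hAv : ∀ i, A (v i) = σ i • u i)
    (hAu : ∀ i, ContinuousLinearMap.adjoint A (u i) = σ i • v i) (c : ℕ → ℝ) (x xα : X) (yδ : Y)
    {α : ℝ} (hα : 0 < α) (k : ℕ)
    (h : ContinuousLinearMap.adjoint A (A xα) + α • xα = ContinuousLinearMap.adjoint A yδ) :
    ‖A xα - yδ‖ ≤ ‖A x - yδ‖ + ‖A (x - ∑ n ∈ Finset.range k, c n • v n)‖ +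
      ‖∑ n ∈ Finset.range k, (α * σ n / (σ n ^ 2 + α) * c n) • u n‖ := by
  set p := ∑ n ∈ Finset.range k, c n • v n with hp
  set w := ∑ n ∈ Finset.range k, (σ n ^ 2 / (σ n ^ 2 + α) * c n) • v n with hw
  have hpos : ∀ n, σ n ^ 2 + α ≠ 0 := fun n => by positivity
  have hwp : ContinuousLinearMap.adjoint A (A w) + α • w = ContinuousLinearMap.adjoint A (A p) := by
    simp only [hp, hw, map_sum, map_smul, hAv, hAu, Finset.smul_sum, ← Finset.sum_add_distrib,
      smul_smul, ← add_smul]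
    refine Finset.sum_congr rfl fun n _ => ?_
    congr 1
    have := hpos n
    field_simp
  have hdiff : A w - A p = -∑ n ∈ Finset.range k, (α * σ n / (σ n ^ 2 + α) * c n) • u n := by
    simp only [hp, hw, map_sum, map_smul, hAv, smul_smul, ← Finset.sum_sub_distrib, ← sub_smul,
      ← Finset.sum_neg_distrib, ← neg_smul]
    refine Finset.sum_congr rfl fun n _ => ?_
    congr 1
    have := hpos n
    field_simp
    ring
  have hd : ContinuousLinearMap.adjoint A (A (xα - w)) + α • (xα - w) =
      ContinuousLinearMap.adjoint A (yδ - A p) := by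
    simp only [map_sub, smul_sub]
    rw [← h, ← hwp]
    abel
  have hres := A.norm_apply_sub_le_of_tikhonov hα.le hd
  have hf : ‖yδ - A p‖ ≤ ‖A x - yδ‖ + ‖A (x - p)‖ := by
    rw [show yδ - A p = A (x - p) - (A x - yδ) by rw [map_sub]; abel, add_comm]
    exact norm_sub_le _ _
  have heq : A xα - yδ = (A (xα - w) - (yδ - A p)) + (A w - A p) := by
    rw [map_sub]; abel
  calc ‖A xα - yδ‖ ≤ ‖A (xα - w) - (yδ - A p)‖ + ‖A w - A p‖ := heq ▸ norm_add_le _ _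
    _ ≤ _ := by rw [hdiff, norm_neg]; linarith

/-- The image of the tail of a Fourier series under an operator with singular values `σ`. -/
theorem norm_map_tail_sq_le (A : X →L[ℝ] Y) {v : ℕ → X} {u : ℕ → Y} (hu : Orthonormal ℝ u)
    {σ : ℕ → ℝ} (hσ : Antitone σ) (hσ0 : ∀ i, 0 < σ i) (hAv : ∀ i, A (v i) = σ i • u i)
    {c : ℕ → ℝ} (hc : Summable fun n => c n ^ 2) {x : X} (hx : HasSum (fun n => c n • v n) x)
    (k : ℕ) :
    ‖A (x - ∑ n ∈ Finset.range k, c n • v n)‖ ^ 2 ≤ σ k ^ 2 * ∑' n, c (k + n) ^ 2 := by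
  have hx' : HasSum (fun n => c (n + k) • v (n + k)) (x - ∑ n ∈ Finset.range k, c n • v n) :=
    (hasSum_nat_add_iff' k).2 hx
  have htail : Summable fun n => c (k + n) ^ 2 := by
    simpa only [add_comm k] using (summable_nat_add_iff k).2 hc
  refine le_of_tendsto (((hx'.mapL A).norm).pow 2) (Filter.Eventually.of_forall fun s => ?_)
  have hterm : ∀ n, A (c (n + k) • v (n + k)) = (c (n + k) * σ (n + k)) • u (n + k) := fun n => by
    rw [map_smul, hAv, smul_smul]
  simp only [hterm]
  have hnorm := (hu.comp (· + k) (add_left_injective k)).norm_sum_smul_sq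
    (fun n => c (n + k) * σ (n + k)) s
  simp only [Function.comp_apply] at hnorm
  rw [hnorm]
  calc ∑ n ∈ s, (c (n + k) * σ (n + k)) ^ 2 ≤ ∑ n ∈ s, σ k ^ 2 * c (k + n) ^ 2 := by
        refine Finset.sum_le_sum fun n _ => ?_
        rw [mul_pow, mul_comm, add_comm k n]
        gcongr
        · exact (hσ0 _).le
        · exact hσ (Nat.le_add_left k n)
    _ = σ k ^ 2 * ∑ n ∈ s, c (k + n) ^ 2 := by rw [Finset.mul_sum]
    _ ≤ _ := by
        gcongr
        exact htail.sum_le_tsum s fun n _ => sq_nonneg _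

end InnerProductSpace

/-- Under the tail-sum Hölder source condition with `0 < μ < 1/2`, the heuristic-discrepancy
functional `‖A x_α^δ - y^δ‖²/α` is bounded, up to a constant independent of `δ` and `α`, by the
a-priori error functional `α^(2μ) + δ²/α`, for all sufficiently small `α`. -/
theorem heuristic_discrepancy_majorant
    {X Y : Type*} [NormedAddCommGroup X] [InnerProductSpace ℝ X] [CompleteSpace X]
    [NormedAddCommGroup Y] [InnerProductSpace ℝ Y] [CompleteSpace Y]
    (A : X →L[ℝ] Y) (v : ℕ → X) (u : ℕ → Y)
    (hv : Orthonormal ℝ v) (hu : Orthonormal ℝ u)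
    (σ : ℕ → ℝ) (hσ_anti : Antitone σ) (hσ_pos : ∀ i, 0 < σ i) (hσ_le : ∀ i, σ i ≤ 1)
    (hσ_lim : Filter.Tendsto σ Filter.atTop (nhds 0))
    (hAv : ∀ i, A (v i) = σ i • u i)
    (hAu : ∀ i, (ContinuousLinearMap.adjoint A) (u i) = σ i • v i)
    (xdag : X) (hxdag : xdag ∈ (Submodule.span ℝ (Set.range v)).topologicalClosure)
    (μ : ℝ) (hμ : 0 < μ) (hμ' : μ < 1 / 2)
    (C' : ℝ) (hC' : 0 < C') (k₀ : ℕ)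
    (htail : ∀ k : ℕ, k₀ ≤ k → ∑' n : ℕ, ⟪xdag, v (k + n)⟫ ^ 2 ≤ C' * σ k ^ (4 * μ))
    (y : Y) (hy : y = A xdag) :
    ∃ C > (0 : ℝ), ∃ α₀ > (0 : ℝ), ∀ δ : ℝ, 0 ≤ δ → ∀ yδ : Y, ‖y - yδ‖ ≤ δ →
      ∀ α : ℝ, 0 < α → α ≤ α₀ →
        ∀ xαδ : X, (ContinuousLinearMap.adjoint A) (A xαδ) + α • xαδ
            = (ContinuousLinearMap.adjoint A) yδ →
          ‖A xαδ - yδ‖ ^ 2 / α ≤ C * (α ^ (2 * μ) + δ ^ 2 / α) := by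
  set c : ℕ → ℝ := fun n => ⟪xdag, v n⟫ with hc
  set T : ℕ → ℝ := fun k => ∑' n, c (k + n) ^ 2 with hTdef
  have hcs : Summable fun n => c n ^ 2 := hv.summable_inner_sq xdag
  have hcs' : ∀ k, Summable fun n => c (k + n) ^ 2 := fun k => by
    simpa only [add_comm k] using (summable_nat_add_iff k).2 hcs
  have hT0 : ∀ k, 0 ≤ T k := fun k => tsum_nonneg fun n => sq_nonneg _
  have hTsucc : ∀ k, T k = c k ^ 2 + T (k + 1) := fun k => by
    simp only [hTdef]
    rw [(hcs' k).tsum_eq_zero_add]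
    simp only [add_zero, add_assoc, add_comm 1]
  have hTanti : Antitone T := antitone_nat_of_succ_le fun k => by
    linarith [hTsucc k, sq_nonneg (c k)]
  have hpow : ∀ k, σ k ^ (4 * μ) = (σ k ^ 2) ^ (2 * μ) := fun k => by
    rw [← Real.rpow_natCast, ← Real.rpow_mul (hσ_pos k).le]
    congr 1
    push_cast
    ring
  -- Enlarging the constant makes the source condition hold at every index.
  obtain ⟨C, hC, hTC⟩ : ∃ C > 0, ∀ k, T k ≤ C * (σ k ^ 2) ^ (2 * μ) := by
    have hσk₀ : 0 < σ k₀ ^ (4 * μ) := Real.rpow_pos_of_pos (hσ_pos k₀) _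
    have hnn : 0 ≤ T 0 / σ k₀ ^ (4 * μ) := div_nonneg (hT0 0) hσk₀.le
    refine ⟨C' + T 0 / σ k₀ ^ (4 * μ), by positivity, fun k => ?_⟩
    have hσk : 0 < σ k ^ (4 * μ) := Real.rpow_pos_of_pos (hσ_pos k) _
    rw [← hpow, add_mul]
    rcases le_total k₀ k with hk | hk
    · linarith [htail k hk, mul_nonneg hnn hσk.le]
    · have h₁ : σ k₀ ^ (4 * μ) ≤ σ k ^ (4 * μ) :=
        Real.rpow_le_rpow (hσ_pos k₀).le (hσ_anti hk) (by linarith)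
      have h₂ := mul_le_mul_of_nonneg_left h₁ hnn
      rw [div_mul_cancel₀ _ hσk₀.ne'] at h₂
      linarith [hTanti k.zero_le, mul_pos hC' hσk]
  have hθ : 0 < 1 - 2 * μ := by linarith
  have hD : 0 < C / (1 - 2 * μ) := div_pos hC hθ
  refine ⟨3 * (1 + C + C / (1 - 2 * μ)), by positivity, 1, one_pos, ?_⟩
  intro δ hδ yδ hyδ α hα _ xα hxα
  have hex : ∃ k, σ k ^ 2 ≤ α := by
    have h : Filter.Tendsto (fun k => σ k ^ 2) Filter.atTop (nhds 0) := by
      simpa using hσ_lim.pow 2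
    exact (h.eventually (eventually_le_nhds hα)).exists
  classical
  obtain ⟨k, hk, hmin⟩ : ∃ k, σ k ^ 2 ≤ α ∧ ∀ m < k, α < σ m ^ 2 :=
    ⟨Nat.find hex, Nat.find_spec hex, fun m hm => not_le.1 (Nat.find_min hex hm)⟩
  set E := α * α ^ (2 * μ) with hE
  have hE0 : 0 < E := by positivity
  have ha : ‖A (xdag - ∑ n ∈ Finset.range k, c n • v n)‖ ^ 2 ≤ C * E := by
    refine (norm_map_tail_sq_le A hu hσ_anti hσ_pos hAv hcs (hv.hasSum_inner_smul hxdag) k).trans ?_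
    calc σ k ^ 2 * T k ≤ α * (C * α ^ (2 * μ)) := by
          refine mul_le_mul hk ((hTC k).trans ?_) (hT0 k) hα.le
          gcongr
      _ = C * E := by rw [hE]; ring
  have hb : ‖∑ n ∈ Finset.range k, (α * σ n / (σ n ^ 2 + α) * c n) • u n‖ ^ 2
      ≤ C / (1 - 2 * μ) * E := by
    rw [hu.norm_sum_smul_sq fun n => α * σ n / (σ n ^ 2 + α) * c n]
    rcases k with _ | j
    · simpa using mul_nonneg hD.le hE0.le
    set s : ℕ → ℝ := fun n => (σ n ^ 2)⁻¹ with hs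
    have hs0 : ∀ n, 0 < s n := fun n => inv_pos.2 (pow_pos (hσ_pos n) 2)
    have hsmono : Monotone s := fun m n hmn =>
      inv_anti₀ (pow_pos (hσ_pos n) 2) (pow_le_pow_left₀ (hσ_pos n).le (hσ_anti hmn) 2)
    have hTs : ∀ n, T n ≤ C * s n ^ ((1 - 2 * μ) - 1) := fun n => by
      convert hTC n using 2
      rw [hs, Real.inv_rpow (sq_nonneg _), ← Real.rpow_neg (sq_nonneg _)]
      congr 1
      ring
    have hparts := sum_sub_mul_add_le_rpow hsmono hs0 hθ (by linarith) hC.le hTs j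
    have hsj : s j ^ (1 - 2 * μ) ≤ (α⁻¹) ^ (1 - 2 * μ) :=
      Real.rpow_le_rpow (hs0 j).le (inv_anti₀ hα (hmin j j.lt_succ_self).le) hθ.le
    have hα' : α ^ 2 * (α⁻¹) ^ (1 - 2 * μ) = E := by
      rw [hE, Real.inv_rpow hα.le, Real.rpow_sub hα, Real.rpow_one]
      field_simp
    calc ∑ n ∈ Finset.range (j + 1), (α * σ n / (σ n ^ 2 + α) * c n) ^ 2
        ≤ ∑ n ∈ Finset.range (j + 1), α ^ 2 * ((T n - T (n + 1)) * s n) := by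
          refine Finset.sum_le_sum fun n _ => ?_
          have hσn := hσ_pos n
          have hw : α * σ n / (σ n ^ 2 + α) ≤ α * (σ n)⁻¹ := by
            rw [div_le_iff₀ (by positivity)]
            have : α * (σ n)⁻¹ * (σ n ^ 2 + α) = α * σ n + α ^ 2 * (σ n)⁻¹ := by
              field_simp
            rw [this]
            have : 0 ≤ α ^ 2 * (σ n)⁻¹ := by positivity
            linarith
          have hTn : T n - T (n + 1) = c n ^ 2 := by rw [hTsucc n]; ring
          rw [hTn, mul_pow]
          calc (α * σ n / (σ n ^ 2 + α)) ^ 2 * c n ^ 2 ≤ (α * (σ n)⁻¹) ^ 2 * c n ^ 2 := by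
                gcongr
            _ = α ^ 2 * (c n ^ 2 * s n) := by
                simp only [hs, mul_pow, inv_pow]
                ring
      _ = α ^ 2 * ∑ n ∈ Finset.range (j + 1), (T n - T (n + 1)) * s n := by rw [Finset.mul_sum]
      _ ≤ α ^ 2 * (C / (1 - 2 * μ) * (α⁻¹) ^ (1 - 2 * μ)) := by
          gcongr
          linarith [mul_le_mul_of_nonneg_left hsj hD.le, mul_nonneg (hT0 (j + 1)) (hs0 j).le]
      _ = C / (1 - 2 * μ) * E := by rw [← hα']; ring
  have hres := norm_tikhonov_residual_le A hAv hAu c xdag xα yδ hα k hxα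
  rw [← hy] at hres
  set a := ‖A (xdag - ∑ n ∈ Finset.range k, c n • v n)‖
  set b := ‖∑ n ∈ Finset.range k, (α * σ n / (σ n ^ 2 + α) * c n) • u n‖
  have hsq : ‖A xα - yδ‖ ^ 2 ≤ (δ + a + b) ^ 2 :=
    pow_le_pow_left₀ (norm_nonneg _) (by linarith) 2
  have h3 : (δ + a + b) ^ 2 ≤ 3 * (δ ^ 2 + a ^ 2 + b ^ 2) := by
    nlinarith [sq_nonneg (δ - a), sq_nonneg (a - b), sq_nonneg (δ - b)]
  rw [div_le_iff₀ hα]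
  have hfin : 3 * (1 + C + C / (1 - 2 * μ)) * (α ^ (2 * μ) + δ ^ 2 / α) * α =
      3 * (1 + C + C / (1 - 2 * μ)) * (E + δ ^ 2) := by
    rw [hE]
    field_simp
  rw [hfin]
  nlinarith [mul_nonneg hC.le (sq_nonneg δ), mul_nonneg hD.le (sq_nonneg δ)]
end

section
/- Let X, Y be Hilbert spaces, A : X → Y a bounded linear operator with a singular system: orthonormal families {v_i} ⊂ X, {u_i} ⊂ Y and a nonincreasing sequence σ with 0 < σ_i ≤ 1, σ_i → 0, A v_i = σ_i u_i, A* u_i = σ_i v_i. Let κ > 0 and let x† ∈ X lie in the closed span of {v_i} and satisfy the logarithmic tail source condition: there are C' > 0 and k₀ with Σ_{n=k}^∞ ⟨x†, v_n⟩² ≤ C' (−log(σ_k²))^{−2κ} for all k ≥ k₀ with σ_k² < 1. Set y = A x† and x_α = (A*A + αI)^{-1} A* y. Then there exist C > 0 and α₀ ∈ (0,1) such that ‖A x_α − y‖ ≤ C · √α · (−log α)^{−κ} for all 0 < α ≤ α₀. -/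
open scoped RealInnerProductSpace

/-- The Fourier expansion of a vector in the closed span of an orthonormal family. -/
theorem Orthonormal.hasSum_inner_smul_of_mem_closure
    {ι X : Type*} [NormedAddCommGroup X] [InnerProductSpace ℝ X] [CompleteSpace X]
    {v : ι → X} (hv : Orthonormal ℝ v) {x : X}
    (hx : x ∈ (Submodule.span ℝ (Set.range v)).topologicalClosure) :
    HasSum (fun n => ⟪x, v n⟫ • v n) x := by
  classical
  have hsq : Summable fun n => ‖⟪x, v n⟫‖ ^ 2 := by
    simpa only [real_inner_comm] using hv.inner_products_summable (x := x)
  obtain ⟨s, hs⟩ : Summable fun n => ⟪x, v n⟫ • v n := by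
    have := (hv.orthogonalFamily.summable_iff_norm_sq_summable (fun n => ⟪x, v n⟫)).2 hsq
    simpa [LinearIsometry.toSpanSingleton_apply] using this
  have hinner : ∀ m, ⟪v m, s⟫ = ⟪v m, x⟫ := by
    intro m
    have h1 := (innerSL ℝ (v m)).hasSum hs
    have h2 : HasSum (fun n => innerSL ℝ (v m) (⟪x, v n⟫ • v n)) ⟪v m, x⟫ := by
      convert hasSum_single m ?_ using 1
      · simp [hv.1 m, real_inner_comm]
      · intro n hn
        simp [hv.2 hn.symm]
    exact h1.unique h2
  have hmem : s ∈ (Submodule.span ℝ (Set.range v)).topologicalClosure := by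
    refine (Submodule.isClosed_topologicalClosure _).mem_of_tendsto hs
      (Filter.Eventually.of_forall fun t => ?_)
    exact Submodule.sum_mem _ fun n _ => Submodule.smul_mem _ _
      (Submodule.le_topologicalClosure _ (Submodule.subset_span ⟨n, rfl⟩))
  have horth : s - x ∈ ((Submodule.span ℝ (Set.range v)).topologicalClosure)ᗮ := by
    rw [Submodule.orthogonal_closure, Submodule.mem_orthogonal]
    intro w hw
    induction hw using Submodule.span_induction with
    | mem w hw =>
      obtain ⟨m, rfl⟩ := hw
      rw [inner_sub_right, hinner, sub_self]
    | zero => simp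
    | add a b _ _ ha hb => rw [inner_add_left, ha, hb, add_zero]
    | smul c a _ ha => rw [real_inner_smul_left, ha, mul_zero]
  have hzero : s - x = 0 := by
    have := Submodule.inner_right_of_mem_orthogonal (Submodule.sub_mem _ hmem hx) horth
    simpa using this
  rwa [sub_eq_zero.1 hzero] at hs

/-- The squared distance from a vector of the closed span to its partial Fourier sum is the tail
sum of its squared Fourier coefficients. -/
theorem Orthonormal.norm_sub_sum_range_sq_of_mem_closure
    {X : Type*} [NormedAddCommGroup X] [InnerProductSpace ℝ X] [CompleteSpace X]
    {v : ℕ → X} (hv : Orthonormal ℝ v) {x : X}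
    (hx : x ∈ (Submodule.span ℝ (Set.range v)).topologicalClosure) (k : ℕ) :
    ‖x - ∑ n ∈ Finset.range k, ⟪x, v n⟫ • v n‖ ^ 2 = ∑' n : ℕ, ⟪x, v (k + n)⟫ ^ 2 := by
  set q := x - ∑ n ∈ Finset.range k, ⟪x, v n⟫ • v n with hq
  have hsum : HasSum (fun n => ⟪x, v (n + k)⟫ • v (n + k)) q :=
    (hasSum_nat_add_iff' k).2 (hv.hasSum_inner_smul_of_mem_closure hx)
  have hinner : ∀ n, ⟪q, v (n + k)⟫ = ⟪x, v (n + k)⟫ := by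
    intro n
    rw [hq, inner_sub_left, sum_inner, Finset.sum_eq_zero, sub_zero]
    intro i hi
    have hne : i ≠ n + k := by
      have := Finset.mem_range.1 hi
      omega
    rw [real_inner_smul_left, hv.2 hne, mul_zero]
  have h1 := (innerSL ℝ q).hasSum hsum
  rw [← real_inner_self_eq_norm_sq]
  refine (HasSum.tsum_eq ?_).symm
  have hterm : (fun n => ⟪x, v (k + n)⟫ ^ 2)
      = fun n => innerSL ℝ q (⟪x, v (n + k)⟫ • v (n + k)) := by
    funext n
    simp [hinner, sq, add_comm k n]
  rw [hterm]
  exact h1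

/-- The norm of `A e` where `e` solves the regularized equation with right-hand side `α • q`. -/
theorem norm_apply_sq_le_of_regularized_eq
    {X Y : Type*} [NormedAddCommGroup X] [InnerProductSpace ℝ X] [CompleteSpace X]
    [NormedAddCommGroup Y] [InnerProductSpace ℝ Y] [CompleteSpace Y]
    (A : X →L[ℝ] Y) {α : ℝ} (hα : 0 ≤ α) {e q : X}
    (he : (ContinuousLinearMap.adjoint A) (A e) + α • e = α • q) :
    ‖A e‖ ^ 2 ≤ α * ‖q‖ ^ 2 := by
  have h := congrArg (fun z => ⟪z, e⟫) he
  simp only [inner_add_left, real_inner_smul_left, ContinuousLinearMap.adjoint_inner_left,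
    real_inner_self_eq_norm_sq] at h
  have h2 := mul_le_mul_of_nonneg_left (real_inner_le_norm q e) hα
  nlinarith [mul_nonneg hα (sq_nonneg (‖q‖ - ‖e‖)), mul_nonneg hα (sq_nonneg ‖e‖),
    mul_nonneg hα (sq_nonneg ‖q‖)]

/-- A finite orthonormal combination of vectors, with the Fourier coefficients of `x` damped by
factors of size at most `b`, has norm at most `b * ‖x‖`. -/
theorem Orthonormal.norm_sum_mul_inner_smul_le
    {ι X Y : Type*} [NormedAddCommGroup X] [InnerProductSpace ℝ X]
    [NormedAddCommGroup Y] [InnerProductSpace ℝ Y]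
    {v : ι → X} {u : ι → Y} (hv : Orthonormal ℝ v) (hu : Orthonormal ℝ u)
    (s : Finset ι) (x : X) {b : ℝ} (hb : 0 ≤ b) {d : ι → ℝ} (hd : ∀ i ∈ s, |d i| ≤ b) :
    ‖∑ i ∈ s, (d i * ⟪x, v i⟫) • u i‖ ≤ b * ‖x‖ := by
  refine le_of_sq_le_sq ?_ (by positivity)
  rw [← real_inner_self_eq_norm_sq, hu.inner_sum]
  have hbessel := hv.sum_inner_products_le (s := s) x
  calc ∑ i ∈ s, (starRingEnd ℝ) (d i * ⟪x, v i⟫) * (d i * ⟪x, v i⟫)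
      ≤ ∑ i ∈ s, b ^ 2 * ‖⟪v i, x⟫‖ ^ 2 := by
        refine Finset.sum_le_sum fun i hi => ?_
        have h := sq_le_sq' (abs_le.1 (hd i hi)).1 (abs_le.1 (hd i hi)).2
        have h' := mul_le_mul_of_nonneg_right h (sq_nonneg ⟪x, v i⟫)
        rw [Real.norm_eq_abs, sq_abs, real_inner_comm x (v i), conj_trivial]
        linarith
    _ = b ^ 2 * ∑ i ∈ s, ‖⟪v i, x⟫‖ ^ 2 := (Finset.mul_sum _ _ _).symm
    _ ≤ b ^ 2 * ‖x‖ ^ 2 := by gcongr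
    _ = (b * ‖x‖) ^ 2 := (mul_pow _ _ _).symm

/-- Split estimate of the Tikhonov residual at an index `k` below which all singular values are at
least `c`. -/
theorem tikhonov_residual_le_split
    {X Y : Type*} [NormedAddCommGroup X] [InnerProductSpace ℝ X] [CompleteSpace X]
    [NormedAddCommGroup Y] [InnerProductSpace ℝ Y] [CompleteSpace Y]
    (A : X →L[ℝ] Y) {v : ℕ → X} {u : ℕ → Y} (hv : Orthonormal ℝ v) (hu : Orthonormal ℝ u)
    {σ : ℕ → ℝ} (hAv : ∀ i, A (v i) = σ i • u i)
    (hAu : ∀ i, (ContinuousLinearMap.adjoint A) (u i) = σ i • v i)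
    {α c : ℝ} (hα : 0 < α) (hc : 0 < c) {k : ℕ} (hk : ∀ i < k, c ≤ σ i) {x xα : X}
    (hxα : (ContinuousLinearMap.adjoint A) (A xα) + α • xα
      = (ContinuousLinearMap.adjoint A) (A x)) :
    ‖A xα - A x‖ ≤ α / c * ‖x‖
      + Real.sqrt α * ‖x - ∑ n ∈ Finset.range k, ⟪x, v n⟫ • v n‖ := by
  set p := ∑ n ∈ Finset.range k, ⟪x, v n⟫ • v n with hp
  set ep := ∑ n ∈ Finset.range k, (α / (σ n ^ 2 + α) * ⟪x, v n⟫) • v n with hep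
  have hAep : A ep = ∑ n ∈ Finset.range k, (α * σ n / (σ n ^ 2 + α) * ⟪x, v n⟫) • u n := by
    simp only [hep, map_sum, map_smul, hAv, smul_smul]
    refine Finset.sum_congr rfl fun n _ => ?_
    congr 1
    ring
  have hepeq : (ContinuousLinearMap.adjoint A) (A ep) + α • ep = α • p := by
    rw [hAep, hep, hp, map_sum, Finset.smul_sum, Finset.smul_sum, ← Finset.sum_add_distrib]
    refine Finset.sum_congr rfl fun n _ => ?_
    have : σ n ^ 2 + α ≠ 0 := by positivity
    rw [map_smul, hAu, smul_smul, smul_smul, smul_smul, ← add_smul]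
    congr 1
    field_simp
  have heq : (ContinuousLinearMap.adjoint A) (A (x - xα - ep)) + α • (x - xα - ep)
      = α • (x - p) := by
    simp only [map_sub, smul_sub]
    rw [← hepeq, ← hxα]
    abel
  have hlow : ‖A (x - xα - ep)‖ ≤ Real.sqrt α * ‖x - p‖ := by
    refine le_of_sq_le_sq ?_ (by positivity)
    rw [mul_pow, Real.sq_sqrt hα.le]
    exact norm_apply_sq_le_of_regularized_eq A hα.le heq
  have hhigh : ‖A ep‖ ≤ α / c * ‖x‖ := by
    rw [hAep]
    refine hv.norm_sum_mul_inner_smul_le hu _ x (by positivity) fun i hi => ?_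
    have hσ := hk i (Finset.mem_range.1 hi)
    have hσ0 : 0 < σ i := hc.trans_le hσ
    rw [abs_of_nonneg (by positivity), div_le_div_iff₀ (by positivity) hc]
    nlinarith [mul_le_mul_of_nonneg_left hσ (mul_pos hα hσ0).le, mul_pos hα hα]
  calc ‖A xα - A x‖ = ‖A ep + A (x - xα - ep)‖ := by
        rw [← norm_neg, ← map_add]
        simp [map_sub]
    _ ≤ ‖A ep‖ + ‖A (x - xα - ep)‖ := norm_add_le _ _
    _ ≤ _ := add_le_add hhigh hlow

/-- Low-smoothness (logarithmic) case: if `x†` satisfies the logarithmic tail source condition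
`Σ_{n≥k} ⟨x†, v_n⟩² ≤ C' (-log σ_k²)^(-2κ)`, then the noise-free Tikhonov residual satisfies
`‖A x_α - y‖ ≤ C √α (-log α)^(-κ)` for all sufficiently small `α`. -/
theorem residual_rate_logarithmic_source_condition
    {X Y : Type*} [NormedAddCommGroup X] [InnerProductSpace ℝ X] [CompleteSpace X]
    [NormedAddCommGroup Y] [InnerProductSpace ℝ Y] [CompleteSpace Y]
    (A : X →L[ℝ] Y) (v : ℕ → X) (u : ℕ → Y)
    (hv : Orthonormal ℝ v) (hu : Orthonormal ℝ u)
    (σ : ℕ → ℝ) (hσ_anti : Antitone σ) (hσ_pos : ∀ i, 0 < σ i) (hσ_le : ∀ i, σ i ≤ 1)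
    (hσ_lim : Filter.Tendsto σ Filter.atTop (nhds 0))
    (hAv : ∀ i, A (v i) = σ i • u i)
    (hAu : ∀ i, (ContinuousLinearMap.adjoint A) (u i) = σ i • v i)
    (xdag : X) (hxdag : xdag ∈ (Submodule.span ℝ (Set.range v)).topologicalClosure)
    (κ : ℝ) (hκ : 0 < κ)
    (C' : ℝ) (hC' : 0 < C') (k₀ : ℕ)
    (htail : ∀ k : ℕ, k₀ ≤ k → σ k ^ 2 < 1 →
      ∑' n : ℕ, ⟪xdag, v (k + n)⟫ ^ 2 ≤ C' * (-Real.log (σ k ^ 2)) ^ (-(2 * κ)))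
    (y : Y) (hy : y = A xdag) :
    ∃ C > (0 : ℝ), ∃ α₀ : ℝ, 0 < α₀ ∧ α₀ < 1 ∧ ∀ α : ℝ, 0 < α → α ≤ α₀ →
      ∀ xα : X, (ContinuousLinearMap.adjoint A) (A xα) + α • xα
          = (ContinuousLinearMap.adjoint A) y →
        ‖A xα - y‖ ≤ C * Real.sqrt α * (-Real.log α) ^ (-κ) := by
  have hsmall : ∀ᶠ α : ℝ in nhdsWithin 0 (Set.Ioi 0),
      |Real.log α| ^ κ ≤ α ^ (-(1 / 4) : ℝ) ∧ α < 1 ∧ Real.sqrt α < σ k₀ ^ 2 := by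
    have h1 := (isLittleO_abs_log_rpow_rpow_nhdsGT_zero κ
      (show (-(1 / 4) : ℝ) < 0 by norm_num)).bound one_pos
    have h2 : ∀ᶠ α : ℝ in nhdsWithin 0 (Set.Ioi 0), α < 1 :=
      nhdsWithin_le_nhds (eventually_lt_nhds one_pos)
    have h3 : ∀ᶠ α : ℝ in nhdsWithin 0 (Set.Ioi 0), Real.sqrt α < σ k₀ ^ 2 := by
      refine nhdsWithin_le_nhds (Real.continuous_sqrt.continuousAt.eventually_lt_const ?_)
      simpa using pow_pos (hσ_pos k₀) 2
    filter_upwards [h1, h2, h3, self_mem_nhdsWithin] with α h1 h2 h3 h4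
    have h4 : 0 < α := h4
    rw [Real.norm_of_nonneg (by positivity), Real.norm_of_nonneg (by positivity), one_mul] at h1
    exact ⟨h1, h2, h3⟩
  obtain ⟨a, ha, hsub⟩ := mem_nhdsGT_iff_exists_Ioc_subset.1 hsmall
  have ha : 0 < a := ha
  refine ⟨‖xdag‖ + Real.sqrt C' * 2 ^ κ, by positivity, a, ha, (hsub ⟨ha, le_rfl⟩).2.1, ?_⟩
  intro α hα hαa xα hxα
  obtain ⟨hlog, hα1, hαk⟩ := hsub ⟨hα, hαa⟩
  have hL : 0 < -Real.log α := neg_pos.2 (Real.log_neg hα hα1)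
  rw [abs_of_neg (by linarith)] at hlog
  set L := -Real.log α with hLdef
  set t := α ^ (1 / 4 : ℝ) with ht
  have ht0 : 0 < t := by positivity
  have ht2 : t ^ 2 = Real.sqrt α := by
    rw [ht, ← Real.rpow_natCast, ← Real.rpow_mul hα.le, Real.sqrt_eq_rpow]
    norm_num
  have ht4 : α = t ^ 4 := by
    rw [show t ^ 4 = (t ^ 2) ^ 2 by ring, ht2, Real.sq_sqrt hα.le]
  have htL : t ≤ L ^ (-κ) := by
    rw [Real.rpow_neg hL.le, le_inv_comm₀ ht0 (by positivity), ht, ← Real.rpow_neg hα.le]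
    exact hlog
  have hex : ∃ k, σ k ≤ t := (hσ_lim.eventually_le_const ht0).exists
  classical
  set k := Nat.find hex with hkdef
  have hσk : σ k ≤ t := Nat.find_spec hex
  have hbelow : ∀ i < k, t ≤ σ i := fun i hi => (not_le.1 (Nat.find_min hex hi)).le
  have hk₀ : k₀ ≤ k := by
    by_contra! hlt
    have h1 := (hσ_anti hlt.le).trans hσk
    have h2 := pow_le_pow_left₀ (hσ_pos k₀).le h1 2
    rw [ht2] at h2
    linarith
  have hσk2 : σ k ^ 2 ≤ Real.sqrt α := ht2 ▸ pow_le_pow_left₀ (hσ_pos k).le hσk 2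
  have hsqrt1 : Real.sqrt α < 1 := (Real.sqrt_lt' one_pos).2 (by simpa using hα1)
  have hlogσ : L / 2 ≤ -Real.log (σ k ^ 2) := by
    have := Real.log_le_log (pow_pos (hσ_pos k) 2) hσk2
    rw [Real.log_sqrt hα.le] at this
    linarith
  have hq : ‖xdag - ∑ n ∈ Finset.range k, ⟪xdag, v n⟫ • v n‖
      ≤ Real.sqrt C' * (2 ^ κ * L ^ (-κ)) := by
    refine le_of_sq_le_sq ?_ (by positivity)
    rw [hv.norm_sub_sum_range_sq_of_mem_closure hxdag]
    refine (htail k hk₀ (hσk2.trans_lt hsqrt1)).trans ?_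
    rw [mul_pow, Real.sq_sqrt hC'.le]
    refine mul_le_mul_of_nonneg_left ?_ hC'.le
    calc (-Real.log (σ k ^ 2)) ^ (-(2 * κ)) ≤ (L / 2) ^ (-(2 * κ)) :=
          Real.rpow_le_rpow_of_nonpos (by positivity) hlogσ (by linarith)
      _ = ((L / 2) ^ (-κ)) ^ 2 := by
          rw [← Real.rpow_natCast, ← Real.rpow_mul (by positivity)]
          congr 1
          push_cast
          ring
      _ = (2 ^ κ * L ^ (-κ)) ^ 2 := by
          rw [Real.div_rpow hL.le zero_le_two, Real.rpow_neg zero_le_two, div_inv_eq_mul, mul_comm]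
  subst hy
  have hres := tikhonov_residual_le_split A hv hu hAv hAu hα ht0 hbelow hxα
  have hαt : α / t = Real.sqrt α * t := by
    rw [← ht2, div_eq_iff ht0.ne']
    linarith [show t ^ 2 * t * t = t ^ 4 by ring]
  rw [hαt] at hres
  calc ‖A xα - A xdag‖ ≤ _ := hres
    _ ≤ Real.sqrt α * L ^ (-κ) * ‖xdag‖
        + Real.sqrt α * (Real.sqrt C' * (2 ^ κ * L ^ (-κ))) := by gcongr
    _ = (‖xdag‖ + Real.sqrt C' * 2 ^ κ) * Real.sqrt α * L ^ (-κ) := by ring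
end
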